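/- arXiv:2211.07464 — 10 statements merged into one kernel-verified Lean document; each statement's English description precedes it below -/
import Mathlib

section
/- Let r₁, r₂, r₃ > 0 be radii and I₁, I₂, I₃ > 1 be weights, with induced inversive distance edge lengths l_{ij}. Then l₁₂, l₁₃, l₂₃ satisfy the three strict triangle inequalities (i.e. they generate a non-degenerate Euclidean triangle) if and only if Q > 0; and they satisfy the non-strict triangle inequalities with equality in one of them (i.e. they generate a degenerate Euclidean triangle) if and only if Q = 0. -/
theorem mul_mul_pos_iff_of_add_pos {x y z : ℝ} (hxy : 0 < x + y) (hxz : 0 < x + z)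
    (hyz : 0 < y + z) : 0 < x * y * z ↔ 0 < x ∧ 0 < y ∧ 0 < z := by
  refine ⟨fun h => ?_, fun ⟨hx, hy, hz⟩ => by positivity⟩
  refine ⟨?_, ?_, ?_⟩ <;> by_contra! hn
  · nlinarith [mul_pos (by linarith : 0 < y) (by linarith : 0 < z)]
  · nlinarith [mul_pos (by linarith : 0 < x) (by linarith : 0 < z)]
  · nlinarith [mul_pos (by linarith : 0 < x) (by linarith : 0 < y)]

theorem mul_mul_eq_zero_iff_of_add_pos {x y z : ℝ} (hxy : 0 < x + y) (hxz : 0 < x + z)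
    (hyz : 0 < y + z) :
    x * y * z = 0 ↔ 0 ≤ x ∧ 0 ≤ y ∧ 0 ≤ z ∧ (x = 0 ∨ y = 0 ∨ z = 0) := by
  rw [mul_eq_zero, mul_eq_zero, or_assoc]
  refine ⟨fun h => ?_, fun h => h.2.2.2⟩
  refine ⟨?_, ?_, ?_, h⟩ <;> rcases h with h | h | h <;> linarith

/-- Heron's product for the squared edge lengths of an inversive distance triangle. -/
theorem heron_inversive_distance {r₁ r₂ r₃ I₁ I₂ I₃ a b c : ℝ}
    (hr₁ : r₁ ≠ 0) (hr₂ : r₂ ≠ 0) (hr₃ : r₃ ≠ 0)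
    (ha : a ^ 2 = r₁ ^ 2 + r₂ ^ 2 + 2 * r₁ * r₂ * I₃)
    (hb : b ^ 2 = r₁ ^ 2 + r₃ ^ 2 + 2 * r₁ * r₃ * I₂)
    (hc : c ^ 2 = r₂ ^ 2 + r₃ ^ 2 + 2 * r₂ * r₃ * I₁) :
    (a + b + c) * ((b + c - a) * (a + c - b) * (a + b - c)) =
      4 * (r₁ * r₂ * r₃) ^ 2 *
        ((1 / r₁) ^ 2 * (1 - I₁ ^ 2) + (1 / r₂) ^ 2 * (1 - I₂ ^ 2) + (1 / r₃) ^ 2 * (1 - I₃ ^ 2)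
          + 2 * (1 / r₁) * (1 / r₂) * (I₃ + I₁ * I₂) + 2 * (1 / r₁) * (1 / r₃) * (I₂ + I₁ * I₃)
          + 2 * (1 / r₂) * (1 / r₃) * (I₁ + I₂ * I₃)) := by
  have heron : (a + b + c) * ((b + c - a) * (a + c - b) * (a + b - c)) =
      4 * a ^ 2 * b ^ 2 - (a ^ 2 + b ^ 2 - c ^ 2) ^ 2 := by ring
  rw [heron, ha, hb, hc]
  field_simp
  ring

/-- Lemma 2.2(a): the inversive distance edge lengths `l₁₂, l₁₃, l₂₃` generate a
non-degenerate Euclidean triangle iff `Q > 0`, and a degenerate one iff `Q = 0`. -/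
theorem stmt_0 (r₁ r₂ r₃ I₁ I₂ I₃ l₁₂ l₁₃ l₂₃ κ₁ κ₂ κ₃ γ₁ γ₂ γ₃ Q : ℝ)
    (hr₁ : 0 < r₁) (hr₂ : 0 < r₂) (hr₃ : 0 < r₃)
    (hI₁ : 1 < I₁) (hI₂ : 1 < I₂) (hI₃ : 1 < I₃)
    (hl₁₂ : l₁₂ = Real.sqrt (r₁ ^ 2 + r₂ ^ 2 + 2 * r₁ * r₂ * I₃))
    (hl₁₃ : l₁₃ = Real.sqrt (r₁ ^ 2 + r₃ ^ 2 + 2 * r₁ * r₃ * I₂))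
    (hl₂₃ : l₂₃ = Real.sqrt (r₂ ^ 2 + r₃ ^ 2 + 2 * r₂ * r₃ * I₁))
    (hκ₁ : κ₁ = 1 / r₁) (hκ₂ : κ₂ = 1 / r₂) (hκ₃ : κ₃ = 1 / r₃)
    (hγ₁ : γ₁ = I₁ + I₂ * I₃) (hγ₂ : γ₂ = I₂ + I₁ * I₃) (hγ₃ : γ₃ = I₃ + I₁ * I₂)
    (hQ : Q = κ₁ ^ 2 * (1 - I₁ ^ 2) + κ₂ ^ 2 * (1 - I₂ ^ 2) + κ₃ ^ 2 * (1 - I₃ ^ 2)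
        + 2 * κ₁ * κ₂ * γ₃ + 2 * κ₁ * κ₃ * γ₂ + 2 * κ₂ * κ₃ * γ₁) :
    ((l₁₂ < l₁₃ + l₂₃ ∧ l₁₃ < l₁₂ + l₂₃ ∧ l₂₃ < l₁₂ + l₁₃) ↔ 0 < Q) ∧
    ((l₁₂ ≤ l₁₃ + l₂₃ ∧ l₁₃ ≤ l₁₂ + l₂₃ ∧ l₂₃ ≤ l₁₂ + l₁₃ ∧
        (l₁₂ = l₁₃ + l₂₃ ∨ l₁₃ = l₁₂ + l₂₃ ∨ l₂₃ = l₁₂ + l₁₃)) ↔ Q = 0) := by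
  have e₁₂ : 0 < r₁ ^ 2 + r₂ ^ 2 + 2 * r₁ * r₂ * I₃ := by positivity
  have e₁₃ : 0 < r₁ ^ 2 + r₃ ^ 2 + 2 * r₁ * r₃ * I₂ := by positivity
  have e₂₃ : 0 < r₂ ^ 2 + r₃ ^ 2 + 2 * r₂ * r₃ * I₁ := by positivity
  have p₁₂ : 0 < l₁₂ := hl₁₂ ▸ Real.sqrt_pos.2 e₁₂
  have p₁₃ : 0 < l₁₃ := hl₁₃ ▸ Real.sqrt_pos.2 e₁₃
  have p₂₃ : 0 < l₂₃ := hl₂₃ ▸ Real.sqrt_pos.2 e₂₃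
  have heron := heron_inversive_distance hr₁.ne' hr₂.ne' hr₃.ne'
    (hl₁₂ ▸ Real.sq_sqrt e₁₂.le) (hl₁₃ ▸ Real.sq_sqrt e₁₃.le) (hl₂₃ ▸ Real.sq_sqrt e₂₃.le)
  subst hκ₁ hκ₂ hκ₃ hγ₁ hγ₂ hγ₃
  rw [← hQ] at heron
  have hs : 0 < l₁₂ + l₁₃ + l₂₃ := by positivity
  have hr : 0 < 4 * (r₁ * r₂ * r₃) ^ 2 := by positivity
  have hx : 0 < (l₁₃ + l₂₃ - l₁₂) + (l₁₂ + l₂₃ - l₁₃) := by linarith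
  have hy : 0 < (l₁₃ + l₂₃ - l₁₂) + (l₁₂ + l₁₃ - l₂₃) := by linarith
  have hz : 0 < (l₁₂ + l₂₃ - l₁₃) + (l₁₂ + l₁₃ - l₂₃) := by linarith
  constructor
  · rw [← mul_pos_iff_of_pos_left hr, ← heron, mul_pos_iff_of_pos_left hs,
      mul_mul_pos_iff_of_add_pos hx hy hz, sub_pos, sub_pos, sub_pos]
  · rw [← mul_eq_zero_iff_left hr.ne', ← heron, mul_eq_zero_iff_left hs.ne',
      mul_mul_eq_zero_iff_of_add_pos hx hy hz, sub_nonneg, sub_nonneg, sub_nonneg,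
      sub_eq_zero, sub_eq_zero, sub_eq_zero, eq_comm (a := l₁₂), eq_comm (a := l₁₃),
      eq_comm (a := l₂₃)]
end

section
/- Define A_i = I_i² − 1, B_i = −2(κ_j γ_k + κ_k γ_j), and Δ_i = 4(I₁² + I₂² + I₃² + 2I₁I₂I₃ − 1)(κ_j² + κ_k² + 2κ_jκ_k I_i) for {i,j,k} = {1,2,3}. Then a triple (r₁, r₂, r₃) ∈ ℝ³_{>0} fails to be admissible if and only if κ_i ≥ (−B_i + sqrt(Δ_i))/(2A_i) for some index i ∈ {1,2,3}; moreover such an index i is unique, i.e. the three sets V_i = {(r₁,r₂,r₃) ∈ ℝ³_{>0} : κ_i ≥ (−B_i + sqrt(Δ_i))/(2A_i)} are pairwise disjoint, and the admissible space equals ℝ³_{>0} minus their disjoint union. -/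
theorem larger_root_le_iff {A B C D x : ℝ} (hA : 0 < A) (hD : D = B ^ 2 - 4 * A * C) :
    x ≥ (-B + Real.sqrt D) / (2 * A) ↔ 0 ≤ 2 * A * x + B ∧ 0 ≤ A * x ^ 2 + B * x + C := by
  have h : x ≥ (-B + Real.sqrt D) / (2 * A) ↔ Real.sqrt D ≤ 2 * A * x + B := by
    rw [ge_iff_le, div_le_iff₀ (by positivity)]
    constructor <;> intro h <;> linarith
  rw [h, Real.sqrt_le_iff, hD]
  refine and_congr_right fun _ => ?_
  have e : (2 * A * x + B) ^ 2 - (B ^ 2 - 4 * A * C) = 4 * A * (A * x ^ 2 + B * x + C) := by ring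
  rw [← sub_nonneg, e]
  exact mul_nonneg_iff_of_pos_left (by positivity)

/-- Heron's criterion for the strict triangle inequalities. -/
theorem triangle_ineqs_iff_heron_pos {a b c : ℝ} (ha : 0 < a) (hb : 0 < b) (hc : 0 < c) :
    (a < b + c ∧ b < a + c ∧ c < a + b) ↔
      0 < 4 * a ^ 2 * b ^ 2 - (a ^ 2 + b ^ 2 - c ^ 2) ^ 2 := by
  have e : 4 * a ^ 2 * b ^ 2 - (a ^ 2 + b ^ 2 - c ^ 2) ^ 2 =
      (a + b + c) * ((b + c - a) * (a + c - b) * (a + b - c)) := by ring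
  rw [e, mul_pos_iff_of_pos_left (by positivity)]
  constructor
  · rintro ⟨h₁, h₂, h₃⟩
    exact mul_pos (mul_pos (by linarith) (by linarith)) (by linarith)
  · intro h
    refine ⟨?_, ?_, ?_⟩ <;> by_contra! hle
    · exact absurd h (not_lt.2 (mul_nonpos_of_nonpos_of_nonneg
        (mul_nonpos_of_nonpos_of_nonneg (by linarith) (by linarith)) (by linarith)))
    · exact absurd h (not_lt.2 (mul_nonpos_of_nonpos_of_nonneg
        (mul_nonpos_of_nonneg_of_nonpos (by linarith) (by linarith)) (by linarith)))
    · exact absurd h (not_lt.2 (mul_nonpos_of_nonneg_of_nonpos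
        (mul_nonneg (by linarith) (by linarith)) (by linarith)))

/-- Two partial derivatives of the quadratic form
`∑ (1 - Iᵢ ^ 2) xᵢ ^ 2 + 2 ∑ (Iₖ + Iᵢ Iⱼ) xᵢ xⱼ` with weights above `1` cannot both be nonpositive
at a positive point. -/
theorem not_both_partials_nonpos {x y z I J K : ℝ} (hx : 0 < x) (hy : 0 < y) (hz : 0 < z)
    (hI : 1 < I) (hJ : 1 < J) (hK : 1 < K)
    (h₁ : y * (K + I * J) + z * (J + I * K) ≤ (I ^ 2 - 1) * x)
    (h₂ : x * (K + I * J) + z * (I + J * K) ≤ (J ^ 2 - 1) * y) : False := by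
  have h₁' : y * (K + I * J) < (I ^ 2 - 1) * x := by
    have : 0 < z * (J + I * K) := by positivity
    linarith
  have h₂' : x * (K + I * J) < (J ^ 2 - 1) * y := by
    have : 0 < z * (I + J * K) := by positivity
    linarith
  have h := mul_lt_mul'' h₁' h₂' (by positivity) (by positivity)
  have hxy : 0 < x * y := by positivity
  have hc : 0 < (K + I * J) ^ 2 - (I ^ 2 - 1) * (J ^ 2 - 1) := by
    have e : (K + I * J) ^ 2 - (I ^ 2 - 1) * (J ^ 2 - 1) =
        K ^ 2 + 2 * K * (I * J) + I ^ 2 + (J ^ 2 - 1) := by ring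
    have : 0 < J ^ 2 - 1 := by nlinarith
    rw [e]
    positivity
  have := mul_pos hxy hc
  linarith

/-- Lemma 2.2(b): a triple of positive radii fails to be admissible iff
`κᵢ ≥ (−Bᵢ + √Δᵢ)/(2Aᵢ)` for some (necessarily unique) index `i`; so the
admissible space is `ℝ³_{>0}` minus the disjoint union of the sets `Vᵢ`. -/
theorem stmt_1 (r₁ r₂ r₃ I₁ I₂ I₃ l₁₂ l₁₃ l₂₃ κ₁ κ₂ κ₃ γ₁ γ₂ γ₃ : ℝ)
    (hr₁ : 0 < r₁) (hr₂ : 0 < r₂) (hr₃ : 0 < r₃)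
    (hI₁ : 1 < I₁) (hI₂ : 1 < I₂) (hI₃ : 1 < I₃)
    (hl₁₂ : l₁₂ = Real.sqrt (r₁ ^ 2 + r₂ ^ 2 + 2 * r₁ * r₂ * I₃))
    (hl₁₃ : l₁₃ = Real.sqrt (r₁ ^ 2 + r₃ ^ 2 + 2 * r₁ * r₃ * I₂))
    (hl₂₃ : l₂₃ = Real.sqrt (r₂ ^ 2 + r₃ ^ 2 + 2 * r₂ * r₃ * I₁))
    (hκ₁ : κ₁ = 1 / r₁) (hκ₂ : κ₂ = 1 / r₂) (hκ₃ : κ₃ = 1 / r₃)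
    (hγ₁ : γ₁ = I₁ + I₂ * I₃) (hγ₂ : γ₂ = I₂ + I₁ * I₃) (hγ₃ : γ₃ = I₃ + I₁ * I₂)
    (A₁ A₂ A₃ B₁ B₂ B₃ Δ₁ Δ₂ Δ₃ : ℝ)
    (hA₁ : A₁ = I₁ ^ 2 - 1) (hA₂ : A₂ = I₂ ^ 2 - 1) (hA₃ : A₃ = I₃ ^ 2 - 1)
    (hB₁ : B₁ = -2 * (κ₂ * γ₃ + κ₃ * γ₂))
    (hB₂ : B₂ = -2 * (κ₁ * γ₃ + κ₃ * γ₁))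
    (hB₃ : B₃ = -2 * (κ₁ * γ₂ + κ₂ * γ₁))
    (hΔ₁ : Δ₁ = 4 * (I₁ ^ 2 + I₂ ^ 2 + I₃ ^ 2 + 2 * I₁ * I₂ * I₃ - 1)
        * (κ₂ ^ 2 + κ₃ ^ 2 + 2 * κ₂ * κ₃ * I₁))
    (hΔ₂ : Δ₂ = 4 * (I₁ ^ 2 + I₂ ^ 2 + I₃ ^ 2 + 2 * I₁ * I₂ * I₃ - 1)
        * (κ₁ ^ 2 + κ₃ ^ 2 + 2 * κ₁ * κ₃ * I₂))
    (hΔ₃ : Δ₃ = 4 * (I₁ ^ 2 + I₂ ^ 2 + I₃ ^ 2 + 2 * I₁ * I₂ * I₃ - 1)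
        * (κ₁ ^ 2 + κ₂ ^ 2 + 2 * κ₁ * κ₂ * I₃)) :
    (¬ (l₁₂ < l₁₃ + l₂₃ ∧ l₁₃ < l₁₂ + l₂₃ ∧ l₂₃ < l₁₂ + l₁₃) ↔
      (κ₁ ≥ (-B₁ + Real.sqrt Δ₁) / (2 * A₁) ∨
       κ₂ ≥ (-B₂ + Real.sqrt Δ₂) / (2 * A₂) ∨
       κ₃ ≥ (-B₃ + Real.sqrt Δ₃) / (2 * A₃))) ∧
    ¬ (κ₁ ≥ (-B₁ + Real.sqrt Δ₁) / (2 * A₁) ∧ κ₂ ≥ (-B₂ + Real.sqrt Δ₂) / (2 * A₂)) ∧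
    ¬ (κ₁ ≥ (-B₁ + Real.sqrt Δ₁) / (2 * A₁) ∧ κ₃ ≥ (-B₃ + Real.sqrt Δ₃) / (2 * A₃)) ∧
    ¬ (κ₂ ≥ (-B₂ + Real.sqrt Δ₂) / (2 * A₂) ∧ κ₃ ≥ (-B₃ + Real.sqrt Δ₃) / (2 * A₃)) := by
  have pκ₁ : 0 < κ₁ := by rw [hκ₁]; positivity
  have pκ₂ : 0 < κ₂ := by rw [hκ₂]; positivity
  have pκ₃ : 0 < κ₃ := by rw [hκ₃]; positivity
  have pA₁ : 0 < A₁ := by rw [hA₁]; exact sub_pos.2 (one_lt_pow₀ hI₁ two_ne_zero)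
  have pA₂ : 0 < A₂ := by rw [hA₂]; exact sub_pos.2 (one_lt_pow₀ hI₂ two_ne_zero)
  have pA₃ : 0 < A₃ := by rw [hA₃]; exact sub_pos.2 (one_lt_pow₀ hI₃ two_ne_zero)
  have heron : (l₁₂ < l₁₃ + l₂₃ ∧ l₁₃ < l₁₂ + l₂₃ ∧ l₂₃ < l₁₂ + l₁₃) ↔
      0 < κ₁ ^ 2 * (1 - I₁ ^ 2) + κ₂ ^ 2 * (1 - I₂ ^ 2) + κ₃ ^ 2 * (1 - I₃ ^ 2)
        + 2 * κ₁ * κ₂ * γ₃ + 2 * κ₁ * κ₃ * γ₂ + 2 * κ₂ * κ₃ * γ₁ := by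
    have s₁₂ : l₁₂ ^ 2 = r₁ ^ 2 + r₂ ^ 2 + 2 * r₁ * r₂ * I₃ := by
      rw [hl₁₂, Real.sq_sqrt (by positivity)]
    have s₁₃ : l₁₃ ^ 2 = r₁ ^ 2 + r₃ ^ 2 + 2 * r₁ * r₃ * I₂ := by
      rw [hl₁₃, Real.sq_sqrt (by positivity)]
    have s₂₃ : l₂₃ ^ 2 = r₂ ^ 2 + r₃ ^ 2 + 2 * r₂ * r₃ * I₁ := by
      rw [hl₂₃, Real.sq_sqrt (by positivity)]
    have e : 4 * l₁₂ ^ 2 * l₁₃ ^ 2 - (l₁₂ ^ 2 + l₁₃ ^ 2 - l₂₃ ^ 2) ^ 2 = 4 * (r₁ * r₂ * r₃) ^ 2 *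
        (κ₁ ^ 2 * (1 - I₁ ^ 2) + κ₂ ^ 2 * (1 - I₂ ^ 2) + κ₃ ^ 2 * (1 - I₃ ^ 2)
          + 2 * κ₁ * κ₂ * γ₃ + 2 * κ₁ * κ₃ * γ₂ + 2 * κ₂ * κ₃ * γ₁) := by
      rw [s₁₂, s₁₃, s₂₃, hκ₁, hκ₂, hκ₃, hγ₁, hγ₂, hγ₃]
      field_simp
      ring
    rw [triangle_ineqs_iff_heron_pos (by rw [hl₁₂]; positivity) (by rw [hl₁₃]; positivity)
      (by rw [hl₂₃]; positivity), e, mul_pos_iff_of_pos_left (by positivity)]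
  set Q := κ₁ ^ 2 * (1 - I₁ ^ 2) + κ₂ ^ 2 * (1 - I₂ ^ 2) + κ₃ ^ 2 * (1 - I₃ ^ 2)
    + 2 * κ₁ * κ₂ * γ₃ + 2 * κ₁ * κ₃ * γ₂ + 2 * κ₂ * κ₃ * γ₁ with hQ
  have root₁ := larger_root_le_iff (x := κ₁) (B := B₁) (C := -Q - A₁ * κ₁ ^ 2 - B₁ * κ₁) pA₁
    (show Δ₁ = _ by rw [hΔ₁, hQ, hA₁, hB₁, hγ₁, hγ₂, hγ₃]; ring)
  have root₂ := larger_root_le_iff (x := κ₂) (B := B₂) (C := -Q - A₂ * κ₂ ^ 2 - B₂ * κ₂) pA₂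
    (show Δ₂ = _ by rw [hΔ₂, hQ, hA₂, hB₂, hγ₁, hγ₂, hγ₃]; ring)
  have root₃ := larger_root_le_iff (x := κ₃) (B := B₃) (C := -Q - A₃ * κ₃ ^ 2 - B₃ * κ₃) pA₃
    (show Δ₃ = _ by rw [hΔ₃, hQ, hA₃, hB₃, hγ₁, hγ₂, hγ₃]; ring)
  rw [heron, root₁, root₂, root₃]
  refine ⟨⟨fun h => ?_, ?_⟩, ?_, ?_, ?_⟩
  · have hQ0 : Q ≤ 0 := not_lt.1 h
    by_contra! hn
    obtain ⟨n₁, n₂, n₃⟩ := hn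
    have m₁ : 2 * A₁ * κ₁ + B₁ < 0 := by
      by_contra! h'
      linarith [n₁ h']
    have m₂ : 2 * A₂ * κ₂ + B₂ < 0 := by
      by_contra! h'
      linarith [n₂ h']
    have m₃ : 2 * A₃ * κ₃ + B₃ < 0 := by
      by_contra! h'
      linarith [n₃ h']
    have e : 2 * Q = -(κ₁ * (2 * A₁ * κ₁ + B₁) + κ₂ * (2 * A₂ * κ₂ + B₂)
        + κ₃ * (2 * A₃ * κ₃ + B₃)) := by
      rw [hQ, hA₁, hA₂, hA₃, hB₁, hB₂, hB₃]
      ring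
    linarith [mul_neg_of_pos_of_neg pκ₁ m₁, mul_neg_of_pos_of_neg pκ₂ m₂,
      mul_neg_of_pos_of_neg pκ₃ m₃]
  · rintro (⟨-, h⟩ | ⟨-, h⟩ | ⟨-, h⟩) <;> linarith
  · rintro ⟨⟨h, -⟩, ⟨h', -⟩⟩
    subst hA₁ hA₂ hB₁ hB₂ hγ₁ hγ₂ hγ₃
    exact not_both_partials_nonpos pκ₁ pκ₂ pκ₃ hI₁ hI₂ hI₃ (by linarith) (by linarith)
  · rintro ⟨⟨h, -⟩, ⟨h', -⟩⟩
    subst hA₁ hA₃ hB₁ hB₃ hγ₁ hγ₂ hγ₃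
    exact not_both_partials_nonpos pκ₁ pκ₃ pκ₂ hI₁ hI₃ hI₂ (by linarith) (by linarith)
  · rintro ⟨⟨h, -⟩, ⟨h', -⟩⟩
    subst hA₂ hA₃ hB₂ hB₃ hγ₁ hγ₂ hγ₃
    exact not_both_partials_nonpos pκ₂ pκ₃ pκ₁ hI₂ hI₃ hI₁ (by linarith) (by linarith)
end

section
/- If (r₁, r₂, r₃) ∈ ℝ³_{>0} generates a degenerate triangle with flat vertex v_i (i.e. l_{jk} = l_{ij} + l_{ik}), then κ_i = (−B_i + sqrt(Δ_i))/(2A_i), where A_i = I_i² − 1, B_i = −2(κ_j γ_k + κ_k γ_j), and Δ_i = 4(I₁² + I₂² + I₃² + 2I₁I₂I₃ − 1)(κ_j² + κ_k² + 2κ_jκ_k I_i). -/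
/-- If `p` is a root of `A p² - 2 M p - C`, where `A = a² - 1`, `M = q (c + a b) + s (b + a c)` and
`C = q² (1 - b²) + s² (1 - c²) + 2 q s (a + b c)`, and `p` is large enough that
`b q + c s < a p`, then `p` is the larger root. -/
lemma larger_root_of_curvature_quadratic {a b c p q s : ℝ} (ha : 1 < a) (hb : 1 < b) (hc : 1 < c)
    (hq : 0 < q) (hs : 0 < s)
    (hQ : p ^ 2 * (1 - a ^ 2) + q ^ 2 * (1 - b ^ 2) + s ^ 2 * (1 - c ^ 2)
      + 2 * p * q * (c + a * b) + 2 * p * s * (b + a * c) + 2 * q * s * (a + b * c) = 0)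
    (hp : b * q + c * s < a * p) :
    p = (2 * (q * (c + a * b) + s * (b + a * c)) +
      √(4 * (a ^ 2 + b ^ 2 + c ^ 2 + 2 * a * b * c - 1) * (q ^ 2 + s ^ 2 + 2 * q * s * a)))
      / (2 * (a ^ 2 - 1)) := by
  have hA : 0 < a ^ 2 - 1 := by nlinarith
  obtain ⟨t, ht⟩ : ∃ t, a * t = b * q + c * s := ⟨(b * q + c * s) / a, by field_simp⟩
  have htp : t < p := by
    have h : a * t < a * p := ht ▸ hp
    exact lt_of_mul_lt_mul_left h (by linarith)
  have ht0 : 0 < t := by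
    have h : 0 < a * t := ht ▸ by positivity
    exact pos_of_mul_pos_right h (by linarith)
  have hneg : 0 < t ^ 2 + q ^ 2 + s ^ 2 + 2 * t * q * c + 2 * t * s * b + 2 * q * s * a
      + 4 * b * c * q * s := by positivity
  have hprod : 0 < (p - t) * ((a ^ 2 - 1) * (p + t)
      - 2 * (q * (c + a * b) + s * (b + a * c))) := by
    have h : (p - t) * ((a ^ 2 - 1) * (p + t) - 2 * (q * (c + a * b) + s * (b + a * c)))
        = t ^ 2 + q ^ 2 + s ^ 2 + 2 * t * q * c + 2 * t * s * b + 2 * q * s * a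
          + 4 * b * c * q * s := by
      linear_combination -hQ - (a * t - b * q - c * s) * ht
    rwa [h]
  have hderiv : 0 ≤ 2 * (a ^ 2 - 1) * p - 2 * (q * (c + a * b) + s * (b + a * c)) := by
    have h := pos_of_mul_pos_right hprod (sub_pos.2 htp).le
    nlinarith [mul_pos hA (sub_pos.2 htp)]
  have hsq : 4 * (a ^ 2 + b ^ 2 + c ^ 2 + 2 * a * b * c - 1) * (q ^ 2 + s ^ 2 + 2 * q * s * a)
      = (2 * (a ^ 2 - 1) * p - 2 * (q * (c + a * b) + s * (b + a * c))) ^ 2 := by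
    linear_combination 4 * (a ^ 2 - 1) * hQ
  rw [hsq, Real.sqrt_sq hderiv]
  field_simp
  ring

/-- The curvature at the flat vertex of a degenerate inversive distance triangle with radii
`x`, `y`, `z`, where `x` is the radius at the flat vertex. -/
lemma curvature_eq_of_flat_vertex {a b c x y z : ℝ} (ha : 1 < a) (hb : 1 < b) (hc : 1 < c)
    (hx : 0 < x) (hy : 0 < y) (hz : 0 < z)
    (h : √(y ^ 2 + z ^ 2 + 2 * y * z * a)
      = √(x ^ 2 + y ^ 2 + 2 * x * y * c) + √(x ^ 2 + z ^ 2 + 2 * x * z * b)) :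
    1 / x = (2 * (1 / y * (c + a * b) + 1 / z * (b + a * c)) +
      √(4 * (a ^ 2 + b ^ 2 + c ^ 2 + 2 * a * b * c - 1)
        * ((1 / y) ^ 2 + (1 / z) ^ 2 + 2 * (1 / y) * (1 / z) * a))) / (2 * (a ^ 2 - 1)) := by
  have hS := Real.sq_sqrt (show 0 ≤ y ^ 2 + z ^ 2 + 2 * y * z * a by positivity)
  have hP := Real.sq_sqrt (show 0 ≤ x ^ 2 + y ^ 2 + 2 * x * y * c by positivity)
  have hR := Real.sq_sqrt (show 0 ≤ x ^ 2 + z ^ 2 + 2 * x * z * b by positivity)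
  rw [h] at hS
  have hP0 := Real.sqrt_nonneg (x ^ 2 + y ^ 2 + 2 * x * y * c)
  have hR0 := Real.sqrt_nonneg (x ^ 2 + z ^ 2 + 2 * x * z * b)
  generalize √(x ^ 2 + y ^ 2 + 2 * x * y * c) = u at hS hP hP0
  generalize √(x ^ 2 + z ^ 2 + 2 * x * z * b) = v at hS hR hR0
  have huv : u * v = y * z * a - x ^ 2 - x * y * c - x * z * b := by
    linear_combination (hS - hP - hR) / 2
  have hlt : x * y * c + x * z * b < y * z * a := by
    nlinarith [mul_nonneg hP0 hR0, pow_pos hx 2]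
  have hsq : (y * z * a - x ^ 2 - x * y * c - x * z * b) ^ 2
      = (x ^ 2 + y ^ 2 + 2 * x * y * c) * (x ^ 2 + z ^ 2 + 2 * x * z * b) := by
    rw [← huv, ← hP, ← hR]
    ring
  refine larger_root_of_curvature_quadratic ha hb hc (by positivity) (by positivity) ?_ ?_
  · field_simp
    linear_combination -hsq
  · have e : a * (1 / x) - (b * (1 / y) + c * (1 / z))
        = (y * z * a - (x * y * c + x * z * b)) / (x * y * z) := by
      field_simp
      ring
    have : 0 < (y * z * a - (x * y * c + x * z * b)) / (x * y * z) :=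
      div_pos (sub_pos.2 hlt) (by positivity)
    linarith


/-- Corollary 2.3: if `(r₁, r₂, r₃)` generates a degenerate triangle with flat
vertex `vᵢ`, then `κᵢ = (−Bᵢ + √Δᵢ)/(2Aᵢ)`. -/
theorem stmt_2 (r₁ r₂ r₃ I₁ I₂ I₃ l₁₂ l₁₃ l₂₃ κ₁ κ₂ κ₃ γ₁ γ₂ γ₃ : ℝ)
    (hr₁ : 0 < r₁) (hr₂ : 0 < r₂) (hr₃ : 0 < r₃)
    (hI₁ : 1 < I₁) (hI₂ : 1 < I₂) (hI₃ : 1 < I₃)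
    (hl₁₂ : l₁₂ = Real.sqrt (r₁ ^ 2 + r₂ ^ 2 + 2 * r₁ * r₂ * I₃))
    (hl₁₃ : l₁₃ = Real.sqrt (r₁ ^ 2 + r₃ ^ 2 + 2 * r₁ * r₃ * I₂))
    (hl₂₃ : l₂₃ = Real.sqrt (r₂ ^ 2 + r₃ ^ 2 + 2 * r₂ * r₃ * I₁))
    (hκ₁ : κ₁ = 1 / r₁) (hκ₂ : κ₂ = 1 / r₂) (hκ₃ : κ₃ = 1 / r₃)
    (hγ₁ : γ₁ = I₁ + I₂ * I₃) (hγ₂ : γ₂ = I₂ + I₁ * I₃) (hγ₃ : γ₃ = I₃ + I₁ * I₂) :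
    (l₂₃ = l₁₂ + l₁₃ →
      κ₁ = (2 * (κ₂ * γ₃ + κ₃ * γ₂) +
        Real.sqrt (4 * (I₁ ^ 2 + I₂ ^ 2 + I₃ ^ 2 + 2 * I₁ * I₂ * I₃ - 1)
          * (κ₂ ^ 2 + κ₃ ^ 2 + 2 * κ₂ * κ₃ * I₁))) / (2 * (I₁ ^ 2 - 1))) ∧
    (l₁₃ = l₁₂ + l₂₃ →
      κ₂ = (2 * (κ₁ * γ₃ + κ₃ * γ₁) +
        Real.sqrt (4 * (I₁ ^ 2 + I₂ ^ 2 + I₃ ^ 2 + 2 * I₁ * I₂ * I₃ - 1)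
          * (κ₁ ^ 2 + κ₃ ^ 2 + 2 * κ₁ * κ₃ * I₂))) / (2 * (I₂ ^ 2 - 1))) ∧
    (l₁₂ = l₁₃ + l₂₃ →
      κ₃ = (2 * (κ₁ * γ₂ + κ₂ * γ₁) +
        Real.sqrt (4 * (I₁ ^ 2 + I₂ ^ 2 + I₃ ^ 2 + 2 * I₁ * I₂ * I₃ - 1)
          * (κ₁ ^ 2 + κ₂ ^ 2 + 2 * κ₁ * κ₂ * I₃))) / (2 * (I₃ ^ 2 - 1))) := by
  subst hl₁₂ hl₁₃ hl₂₃ hκ₁ hκ₂ hκ₃ hγ₁ hγ₂ hγ₃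
  refine ⟨fun h => ?_, fun h => ?_, fun h => ?_⟩
  · exact curvature_eq_of_flat_vertex hI₁ hI₂ hI₃ hr₁ hr₂ hr₃ h
  · have h' := curvature_eq_of_flat_vertex hI₂ hI₁ hI₃ hr₂ hr₁ hr₃
      (by convert h using 4 <;> ring)
    convert h' using 5 <;> ring
  · have h' := curvature_eq_of_flat_vertex hI₃ hI₁ hI₂ hr₃ hr₁ hr₂
      (by convert h using 4 <;> ring)
    convert h' using 5 <;> ring
end

section
/- On the open set of labels u = (u₁, u₂, u₃) ∈ ℝ³ for which r_i = exp(u_i) gives an admissible triple, each inner angle θ_i is a differentiable function of u, and for distinct i, j with remaining index k one has ∂θ_i/∂u_j = ∂θ_j/∂u_i = h_{ij,k}/l_{ij}; moreover ∂θ_i/∂u_i = −∂θ_i/∂u_j − ∂θ_i/∂u_k < 0. -/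
/-- Edge length of an inversive distance circle packing triangle as a function of
the labels `a, b` (radii `exp a`, `exp b`) and the weight `I` on the edge. -/
noncomputable def ellu (I a b : ℝ) : ℝ :=
  Real.sqrt (Real.exp a ^ 2 + Real.exp b ^ 2 + 2 * Real.exp a * Real.exp b * I)

/-- Inner angle opposite the side of length `z` in a triangle with adjacent side
lengths `x, y`. -/
noncomputable def ang (x y z : ℝ) : ℝ :=
  Real.arccos ((x ^ 2 + y ^ 2 - z ^ 2) / (2 * x * y))

/-- Inner angle at `v₁` as a function of the labels `(a, b, c)` at `(v₁, v₂, v₃)`. -/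
noncomputable def theta1 (I₁ I₂ I₃ a b c : ℝ) : ℝ :=
  ang (ellu I₃ a b) (ellu I₂ a c) (ellu I₁ b c)

/-- Inner angle at `v₂` as a function of the labels `(a, b, c)` at `(v₁, v₂, v₃)`. -/
noncomputable def theta2 (I₁ I₂ I₃ a b c : ℝ) : ℝ :=
  ang (ellu I₃ a b) (ellu I₁ b c) (ellu I₂ a c)

/-- Inner angle at `v₃` as a function of the labels `(a, b, c)` at `(v₁, v₂, v₃)`. -/
noncomputable def theta3 (I₁ I₂ I₃ a b c : ℝ) : ℝ :=
  ang (ellu I₂ a c) (ellu I₁ b c) (ellu I₃ a b)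

/-- The squared edge length `x² + y² + 2xyI` determined by radii `x, y` and weight `I`. -/
def sqLen (I x y : ℝ) : ℝ := x ^ 2 + y ^ 2 + 2 * x * y * I

/-- Sixteen times the squared area of a triangle, in terms of its squared side lengths. -/
def heron (p q s : ℝ) : ℝ := 4 * p * q - (p + q - s) ^ 2

/-- The polynomial `x² y² z² κ_z h_z` in the radii `x, y, z` with opposite weights `I, J, K`. -/
def centerNum (I J K x y z : ℝ) : ℝ :=
  x ^ 2 * y ^ 2 * (1 - K ^ 2) + x * y ^ 2 * z * (J + I * K) + x ^ 2 * y * z * (I + J * K)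

lemma sqLen_pos {I x y : ℝ} (hI : 1 < I) (hx : 0 < x) (hy : 0 < y) : 0 < sqLen I x y := by
  unfold sqLen; positivity

lemma ellu_sq {I a b : ℝ} (hI : 1 < I) :
    ellu I a b ^ 2 = sqLen I (Real.exp a) (Real.exp b) :=
  Real.sq_sqrt (sqLen_pos hI (Real.exp_pos a) (Real.exp_pos b)).le

lemma ellu_pos {I a b : ℝ} (hI : 1 < I) : 0 < ellu I a b :=
  Real.sqrt_pos.2 (sqLen_pos hI (Real.exp_pos a) (Real.exp_pos b))

lemma ellu_comm (I a b : ℝ) : ellu I a b = ellu I b a := by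
  unfold ellu; congr 1; ring

lemma hasDerivAt_ellu_left {I a b : ℝ} (hI : 1 < I) :
    HasDerivAt (fun t => ellu I t b)
      ((Real.exp a ^ 2 + Real.exp a * Real.exp b * I) / ellu I a b) a := by
  have he := Real.hasDerivAt_exp a
  have h := ((((he.fun_pow 2).add_const (Real.exp b ^ 2)).fun_add
    (((he.const_mul 2).mul_const (Real.exp b)).mul_const I)).sqrt
      (sqLen_pos hI (Real.exp_pos a) (Real.exp_pos b)).ne')
  have hp := ellu_pos (a := a) (b := b) hI
  refine h.congr_deriv ?_
  rw [← ellu]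
  field_simp
  ring

lemma hasDerivAt_ellu_right {I a b : ℝ} (hI : 1 < I) :
    HasDerivAt (fun t => ellu I a t)
      ((Real.exp b ^ 2 + Real.exp a * Real.exp b * I) / ellu I a b) b := by
  have h := hasDerivAt_ellu_left (a := b) (b := a) hI
  simp only [ellu_comm I _ a] at h
  convert h using 2
  ring

lemma one_sub_sq_cos_ratio {x y z : ℝ} (hx : 0 < x) (hy : 0 < y) :
    1 - ((x ^ 2 + y ^ 2 - z ^ 2) / (2 * x * y)) ^ 2 =
      heron (x ^ 2) (y ^ 2) (z ^ 2) / (2 * x * y) ^ 2 := by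
  unfold heron; field_simp; ring

lemma sqrt_one_sub_sq_cos_ratio {x y z : ℝ} (hx : 0 < x) (hy : 0 < y) :
    Real.sqrt (1 - ((x ^ 2 + y ^ 2 - z ^ 2) / (2 * x * y)) ^ 2) =
      Real.sqrt (heron (x ^ 2) (y ^ 2) (z ^ 2)) / (2 * x * y) := by
  rw [one_sub_sq_cos_ratio hx hy, Real.sqrt_div' _ (sq_nonneg _), Real.sqrt_sq (by positivity)]

lemma mul_mul_sin_ang {x y z : ℝ} (hx : 0 < x) (hy : 0 < y) :
    x * y * Real.sin (ang x y z) = Real.sqrt (heron (x ^ 2) (y ^ 2) (z ^ 2)) / 2 := by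
  rw [ang, Real.sin_arccos, sqrt_one_sub_sq_cos_ratio hx hy]
  field_simp

lemma cos_ratio_ne {x y z : ℝ} (hx : 0 < x) (hy : 0 < y)
    (hD : 0 < heron (x ^ 2) (y ^ 2) (z ^ 2)) :
    (x ^ 2 + y ^ 2 - z ^ 2) / (2 * x * y) ≠ -1 ∧ (x ^ 2 + y ^ 2 - z ^ 2) / (2 * x * y) ≠ 1 := by
  have h : 0 < 1 - ((x ^ 2 + y ^ 2 - z ^ 2) / (2 * x * y)) ^ 2 := by
    rw [one_sub_sq_cos_ratio hx hy]; positivity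
  constructor <;> intro h' <;> rw [h'] at h <;> norm_num at h

lemma heron_pos {x y z : ℝ} (hx : 0 < x) (hy : 0 < y) (hz : 0 < z)
    (h₁ : x < y + z) (h₂ : y < x + z) (h₃ : z < x + y) :
    0 < heron (x ^ 2) (y ^ 2) (z ^ 2) := by
  have h : heron (x ^ 2) (y ^ 2) (z ^ 2) =
      (x + y + z) * (x + y - z) * (x + z - y) * (y + z - x) := by
    unfold heron; ring
  rw [h]
  have := sub_pos.2 h₁
  have := sub_pos.2 h₂
  have := sub_pos.2 h₃
  positivity

/-- Derivative of an angle when the squared sides have derivatives `2α`, `2β`, `2ζ`. -/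
lemma hasDerivAt_ang {x y z : ℝ → ℝ} {α β ζ t : ℝ}
    (hx : HasDerivAt x (α / x t) t) (hy : HasDerivAt y (β / y t) t)
    (hz : HasDerivAt z (ζ / z t) t) (hx0 : 0 < x t) (hy0 : 0 < y t) (hz0 : 0 < z t)
    (hD : 0 < heron (x t ^ 2) (y t ^ 2) (z t ^ 2)) :
    HasDerivAt (fun t => ang (x t) (y t) (z t))
      (((x t ^ 2 + y t ^ 2 - z t ^ 2) * (α / x t ^ 2 + β / y t ^ 2) - 2 * (α + β - ζ)) /
        Real.sqrt (heron (x t ^ 2) (y t ^ 2) (z t ^ 2))) t := by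
  obtain ⟨hn, hn'⟩ := cos_ratio_ne hx0 hy0 hD
  have hf := (((hx.fun_pow 2).fun_add (hy.fun_pow 2)).fun_sub (hz.fun_pow 2)).fun_div
    ((hx.const_mul 2).fun_mul hy) (by positivity)
  have h := (Real.hasDerivAt_arccos hn hn').comp t hf
  have hs := Real.sqrt_pos.2 hD
  refine h.congr_deriv ?_
  rw [sqrt_one_sub_sq_cos_ratio hx0 hy0]
  field_simp
  ring

lemma differentiableAt_ang {E : Type*} [NormedAddCommGroup E] [NormedSpace ℝ E]
    {x y z : E → ℝ} {t : E} (hx : DifferentiableAt ℝ x t) (hy : DifferentiableAt ℝ y t)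
    (hz : DifferentiableAt ℝ z t) (hx0 : 0 < x t) (hy0 : 0 < y t)
    (hD : 0 < heron (x t ^ 2) (y t ^ 2) (z t ^ 2)) :
    DifferentiableAt ℝ (fun t => ang (x t) (y t) (z t)) t := by
  obtain ⟨hn, hn'⟩ := cos_ratio_ne hx0 hy0 hD
  have hf : DifferentiableAt ℝ (fun t => (x t ^ 2 + y t ^ 2 - z t ^ 2) / (2 * x t * y t)) t := by
    have h₀ : 2 * x t * y t ≠ 0 := by positivity
    fun_prop (disch := exact h₀)
  exact (Real.differentiableAt_arccos.2 ⟨hn, hn'⟩).comp t hf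

lemma differentiableAt_ellu {E : Type*} [NormedAddCommGroup E] [NormedSpace ℝ E]
    {I : ℝ} (hI : 1 < I) {f g : E → ℝ} {t : E}
    (hf : DifferentiableAt ℝ f t) (hg : DifferentiableAt ℝ g t) :
    DifferentiableAt ℝ (fun t => ellu I (f t) (g t)) t :=
  DifferentiableAt.sqrt (by fun_prop)
    (sqLen_pos hI (Real.exp_pos (f t)) (Real.exp_pos (g t))).ne'

lemma heron_rotate (p q s : ℝ) : heron p q s = heron p s q := by
  unfold heron; ring

lemma heron_swap (p q s : ℝ) : heron p q s = heron q p s := by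
  unfold heron; ring

lemma theta2_eq_theta1 (I₁ I₂ I₃ a b c : ℝ) :
    theta2 I₁ I₂ I₃ a b c = theta1 I₂ I₁ I₃ b a c := by
  rw [theta1, theta2, ellu_comm I₃]

lemma theta3_eq_theta1 (I₁ I₂ I₃ a b c : ℝ) :
    theta3 I₁ I₂ I₃ a b c = theta1 I₃ I₁ I₂ c a b := by
  rw [theta1, theta3, ellu_comm I₂, ellu_comm I₁]

lemma hasDerivAt_theta1_snd {I₁ I₂ I₃ a b c : ℝ} (hI₁ : 1 < I₁) (hI₂ : 1 < I₂) (hI₃ : 1 < I₃)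
    (hD : 0 < heron (ellu I₃ a b ^ 2) (ellu I₂ a c ^ 2) (ellu I₁ b c ^ 2)) :
    HasDerivAt (fun t => theta1 I₁ I₂ I₃ a t c)
      (2 * centerNum I₁ I₂ I₃ (Real.exp a) (Real.exp b) (Real.exp c) /
        (ellu I₃ a b ^ 2 *
          Real.sqrt (heron (ellu I₃ a b ^ 2) (ellu I₂ a c ^ 2) (ellu I₁ b c ^ 2)))) b := by
  have hy : HasDerivAt (fun _ : ℝ => ellu I₂ a c) (0 / ellu I₂ a c) b := by
    simpa using hasDerivAt_const b (ellu I₂ a c)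
  have h := hasDerivAt_ang (hasDerivAt_ellu_right (a := a) (b := b) hI₃) hy
    (hasDerivAt_ellu_left (a := b) (b := c) hI₁)
    (ellu_pos hI₃) (ellu_pos hI₂) (ellu_pos hI₁) hD
  have hs := Real.sqrt_pos.2 hD
  have hp := ellu_pos (a := a) (b := b) hI₃
  refine h.congr_deriv ?_
  field_simp
  rw [ellu_sq hI₁, ellu_sq hI₂, ellu_sq hI₃]
  unfold sqLen centerNum
  ring

lemma hasDerivAt_theta1_thd {I₁ I₂ I₃ a b c : ℝ} (hI₁ : 1 < I₁) (hI₂ : 1 < I₂) (hI₃ : 1 < I₃)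
    (hD : 0 < heron (ellu I₃ a b ^ 2) (ellu I₂ a c ^ 2) (ellu I₁ b c ^ 2)) :
    HasDerivAt (fun t => theta1 I₁ I₂ I₃ a b t)
      (2 * centerNum I₁ I₃ I₂ (Real.exp a) (Real.exp c) (Real.exp b) /
        (ellu I₂ a c ^ 2 *
          Real.sqrt (heron (ellu I₃ a b ^ 2) (ellu I₂ a c ^ 2) (ellu I₁ b c ^ 2)))) c := by
  have hx : HasDerivAt (fun _ : ℝ => ellu I₃ a b) (0 / ellu I₃ a b) c := by
    simpa using hasDerivAt_const c (ellu I₃ a b)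
  have h := hasDerivAt_ang hx (hasDerivAt_ellu_right (a := a) (b := c) hI₂)
    (hasDerivAt_ellu_right (a := b) (b := c) hI₁)
    (ellu_pos hI₃) (ellu_pos hI₂) (ellu_pos hI₁) hD
  have hs := Real.sqrt_pos.2 hD
  have hq := ellu_pos (a := a) (b := c) hI₂
  refine h.congr_deriv ?_
  field_simp
  rw [ellu_sq hI₁, ellu_sq hI₂, ellu_sq hI₃]
  unfold sqLen centerNum
  ring

lemma hasDerivAt_theta1_fst {I₁ I₂ I₃ a b c : ℝ} (hI₁ : 1 < I₁) (hI₂ : 1 < I₂) (hI₃ : 1 < I₃)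
    (hD : 0 < heron (ellu I₃ a b ^ 2) (ellu I₂ a c ^ 2) (ellu I₁ b c ^ 2)) :
    HasDerivAt (fun t => theta1 I₁ I₂ I₃ t b c)
      (-(2 * centerNum I₁ I₂ I₃ (Real.exp a) (Real.exp b) (Real.exp c) /
        (ellu I₃ a b ^ 2 *
          Real.sqrt (heron (ellu I₃ a b ^ 2) (ellu I₂ a c ^ 2) (ellu I₁ b c ^ 2)))) -
      2 * centerNum I₁ I₃ I₂ (Real.exp a) (Real.exp c) (Real.exp b) /
        (ellu I₂ a c ^ 2 *
          Real.sqrt (heron (ellu I₃ a b ^ 2) (ellu I₂ a c ^ 2) (ellu I₁ b c ^ 2)))) a := by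
  have hz : HasDerivAt (fun _ : ℝ => ellu I₁ b c) (0 / ellu I₁ b c) a := by
    simpa using hasDerivAt_const a (ellu I₁ b c)
  have h := hasDerivAt_ang (hasDerivAt_ellu_left (a := a) (b := b) hI₃)
    (hasDerivAt_ellu_left (a := a) (b := c) hI₂) hz
    (ellu_pos hI₃) (ellu_pos hI₂) (ellu_pos hI₁) hD
  have hs := Real.sqrt_pos.2 hD
  have hp := ellu_pos (a := a) (b := b) hI₃
  have hq := ellu_pos (a := a) (b := c) hI₂
  refine h.congr_deriv ?_
  field_simp
  rw [ellu_sq hI₁, ellu_sq hI₂, ellu_sq hI₃]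
  unfold sqLen centerNum
  ring

lemma centerNum_mul_sqLen_add_pos {I J K x y z : ℝ} (hI : 1 < I) (hJ : 1 < J) (hK : 1 < K)
    (hx : 0 < x) (hy : 0 < y) (hz : 0 < z)
    (hD : 0 < heron (sqLen K x y) (sqLen J x z) (sqLen I y z)) :
    0 < centerNum I J K x y z * sqLen J x z + centerNum I K J x z y * sqLen K x y := by
  have h : centerNum I J K x y z * sqLen J x z + centerNum I K J x z y * sqLen K x y =
      x ^ 2 * heron (sqLen K x y) (sqLen J x z) (sqLen I y z) / 4 +
      (x * y ^ 2 * z ^ 3 * (J + I * K) + x ^ 2 * y * z ^ 3 * (I + J * K) +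
        x * y ^ 3 * z ^ 2 * (K + I * J) + x ^ 2 * y ^ 3 * z * (I + J * K) +
        x ^ 3 * y * z ^ 2 * (K + I * J) + x ^ 3 * y ^ 2 * z * (J + I * K) +
        x ^ 2 * y ^ 2 * z ^ 2 * (1 + I ^ 2 + J ^ 2 + K ^ 2 + 4 * I * J * K)) := by
    unfold centerNum heron sqLen; ring
  rw [h]
  positivity

lemma neg_centerNum_div_sub_neg {I₁ I₂ I₃ a b c : ℝ}
    (hI₁ : 1 < I₁) (hI₂ : 1 < I₂) (hI₃ : 1 < I₃)
    (hD : 0 < heron (ellu I₃ a b ^ 2) (ellu I₂ a c ^ 2) (ellu I₁ b c ^ 2)) :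
    -(2 * centerNum I₁ I₂ I₃ (Real.exp a) (Real.exp b) (Real.exp c) /
        (ellu I₃ a b ^ 2 *
          Real.sqrt (heron (ellu I₃ a b ^ 2) (ellu I₂ a c ^ 2) (ellu I₁ b c ^ 2)))) -
      2 * centerNum I₁ I₃ I₂ (Real.exp a) (Real.exp c) (Real.exp b) /
        (ellu I₂ a c ^ 2 *
          Real.sqrt (heron (ellu I₃ a b ^ 2) (ellu I₂ a c ^ 2) (ellu I₁ b c ^ 2))) < 0 := by
  have hs := Real.sqrt_pos.2 hD
  have hp := ellu_pos (a := a) (b := b) hI₃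
  have hq := ellu_pos (a := a) (b := c) hI₂
  set s := Real.sqrt (heron (ellu I₃ a b ^ 2) (ellu I₂ a c ^ 2) (ellu I₁ b c ^ 2))
  rw [ellu_sq hI₁, ellu_sq hI₂, ellu_sq hI₃] at hD
  have h := centerNum_mul_sqLen_add_pos hI₁ hI₂ hI₃ (Real.exp_pos a) (Real.exp_pos b)
    (Real.exp_pos c) hD
  rw [← ellu_sq hI₂, ← ellu_sq hI₃] at h
  have h' : 0 < 2 * (centerNum I₁ I₂ I₃ (Real.exp a) (Real.exp b) (Real.exp c) *
      ellu I₂ a c ^ 2 + centerNum I₁ I₃ I₂ (Real.exp a) (Real.exp c) (Real.exp b) *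
      ellu I₃ a b ^ 2) / (ellu I₃ a b ^ 2 * ellu I₂ a c ^ 2 * s) := by positivity
  rw [← neg_pos]
  convert h' using 1
  field_simp
  ring

lemma centerNum_swap (I J K x y z : ℝ) : centerNum I J K x y z = centerNum J I K y x z := by
  unfold centerNum; ring

/-- The edge quantity `h_{ij,k} / l_{ij}` in terms of polynomials in the radii. -/
lemma center_div_eq_centerNum_div {x y z I J K A l D : ℝ}
    (hx : 0 < x) (hy : 0 < y) (hz : 0 < z) (hl : 0 < l) (hD : 0 < D) (hA : A = Real.sqrt D / 2) :
    x ^ 2 * y ^ 2 * z ^ 2 *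
        (1 / z * (1 / z * (1 - K ^ 2) + 1 / x * (J + I * K) + 1 / y * (I + J * K))) /
        (A * l) / l =
      2 * centerNum I J K x y z / (l ^ 2 * Real.sqrt D) := by
  have hs := Real.sqrt_pos.2 hD
  rw [hA]
  unfold centerNum
  field_simp

/-- Lemma 2.4(a): on the admissible set, the inner angles are differentiable in
the label `u = (u₁,u₂,u₃)`, the mixed partials satisfy
`∂θᵢ/∂uⱼ = ∂θⱼ/∂uᵢ = h_{ij,k}/l_{ij}` and
`∂θᵢ/∂uᵢ = −∂θᵢ/∂uⱼ − ∂θᵢ/∂u_k < 0`. -/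
theorem stmt_3 (u₁ u₂ u₃ I₁ I₂ I₃ : ℝ)
    (hI₁ : 1 < I₁) (hI₂ : 1 < I₂) (hI₃ : 1 < I₃)
    (r₁ r₂ r₃ κ₁ κ₂ κ₃ γ₁ γ₂ γ₃ l₁₂ l₁₃ l₂₃ h₁ h₂ h₃ A H₁₂ H₁₃ H₂₃ : ℝ)
    (hr₁ : r₁ = Real.exp u₁) (hr₂ : r₂ = Real.exp u₂) (hr₃ : r₃ = Real.exp u₃)
    (hκ₁ : κ₁ = 1 / r₁) (hκ₂ : κ₂ = 1 / r₂) (hκ₃ : κ₃ = 1 / r₃)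
    (hγ₁ : γ₁ = I₁ + I₂ * I₃) (hγ₂ : γ₂ = I₂ + I₁ * I₃) (hγ₃ : γ₃ = I₃ + I₁ * I₂)
    (hl₁₂ : l₁₂ = ellu I₃ u₁ u₂) (hl₁₃ : l₁₃ = ellu I₂ u₁ u₃) (hl₂₃ : l₂₃ = ellu I₁ u₂ u₃)
    (hadm : l₁₂ < l₁₃ + l₂₃ ∧ l₁₃ < l₁₂ + l₂₃ ∧ l₂₃ < l₁₂ + l₁₃)
    (hh₁ : h₁ = κ₁ * (1 - I₁ ^ 2) + κ₂ * γ₃ + κ₃ * γ₂)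
    (hh₂ : h₂ = κ₂ * (1 - I₂ ^ 2) + κ₁ * γ₃ + κ₃ * γ₁)
    (hh₃ : h₃ = κ₃ * (1 - I₃ ^ 2) + κ₁ * γ₂ + κ₂ * γ₁)
    (hA : A = l₁₂ * l₁₃ * Real.sin (theta1 I₁ I₂ I₃ u₁ u₂ u₃))
    (hH₁₂ : H₁₂ = r₁ ^ 2 * r₂ ^ 2 * r₃ ^ 2 * (κ₃ * h₃) / (A * l₁₂))
    (hH₁₃ : H₁₃ = r₁ ^ 2 * r₂ ^ 2 * r₃ ^ 2 * (κ₂ * h₂) / (A * l₁₃))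
    (hH₂₃ : H₂₃ = r₁ ^ 2 * r₂ ^ 2 * r₃ ^ 2 * (κ₁ * h₁) / (A * l₂₃)) :
    -- differentiability of the three angles in the label `u`
    (DifferentiableAt ℝ (fun p : ℝ × ℝ × ℝ => theta1 I₁ I₂ I₃ p.1 p.2.1 p.2.2) (u₁, u₂, u₃) ∧
     DifferentiableAt ℝ (fun p : ℝ × ℝ × ℝ => theta2 I₁ I₂ I₃ p.1 p.2.1 p.2.2) (u₁, u₂, u₃) ∧
     DifferentiableAt ℝ (fun p : ℝ × ℝ × ℝ => theta3 I₁ I₂ I₃ p.1 p.2.1 p.2.2) (u₁, u₂, u₃)) ∧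
    -- ∂θ₁/∂u₂ = ∂θ₂/∂u₁ = h₁₂,₃ / l₁₂
    (HasDerivAt (fun t => theta1 I₁ I₂ I₃ u₁ t u₃) (H₁₂ / l₁₂) u₂ ∧
     HasDerivAt (fun t => theta2 I₁ I₂ I₃ t u₂ u₃) (H₁₂ / l₁₂) u₁) ∧
    -- ∂θ₁/∂u₃ = ∂θ₃/∂u₁ = h₁₃,₂ / l₁₃
    (HasDerivAt (fun t => theta1 I₁ I₂ I₃ u₁ u₂ t) (H₁₃ / l₁₃) u₃ ∧
     HasDerivAt (fun t => theta3 I₁ I₂ I₃ t u₂ u₃) (H₁₃ / l₁₃) u₁) ∧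
    -- ∂θ₂/∂u₃ = ∂θ₃/∂u₂ = h₂₃,₁ / l₂₃
    (HasDerivAt (fun t => theta2 I₁ I₂ I₃ u₁ u₂ t) (H₂₃ / l₂₃) u₃ ∧
     HasDerivAt (fun t => theta3 I₁ I₂ I₃ u₁ t u₃) (H₂₃ / l₂₃) u₂) ∧
    -- diagonal derivatives: ∂θᵢ/∂uᵢ = −∂θᵢ/∂uⱼ − ∂θᵢ/∂u_k < 0
    (HasDerivAt (fun t => theta1 I₁ I₂ I₃ t u₂ u₃) (-(H₁₂ / l₁₂) - H₁₃ / l₁₃) u₁ ∧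
      -(H₁₂ / l₁₂) - H₁₃ / l₁₃ < 0) ∧
    (HasDerivAt (fun t => theta2 I₁ I₂ I₃ u₁ t u₃) (-(H₁₂ / l₁₂) - H₂₃ / l₂₃) u₂ ∧
      -(H₁₂ / l₁₂) - H₂₃ / l₂₃ < 0) ∧
    (HasDerivAt (fun t => theta3 I₁ I₂ I₃ u₁ u₂ t) (-(H₁₃ / l₁₃) - H₂₃ / l₂₃) u₃ ∧
      -(H₁₃ / l₁₃) - H₂₃ / l₂₃ < 0) := by
  have p₁ := Real.exp_pos u₁
  have p₂ := Real.exp_pos u₂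
  have p₃ := Real.exp_pos u₃
  have q₁₂ : 0 < ellu I₃ u₁ u₂ := ellu_pos hI₃
  have q₁₃ : 0 < ellu I₂ u₁ u₃ := ellu_pos hI₂
  have q₂₃ : 0 < ellu I₁ u₂ u₃ := ellu_pos hI₁
  subst hl₁₂ hl₁₃ hl₂₃
  obtain ⟨t₁, t₂, t₃⟩ := hadm
  have hD := heron_pos q₁₂ q₁₃ q₂₃ t₁ t₂ t₃
  rw [theta1, mul_mul_sin_ang q₁₂ q₁₃] at hA
  set D := heron (ellu I₃ u₁ u₂ ^ 2) (ellu I₂ u₁ u₃ ^ 2) (ellu I₁ u₂ u₃ ^ 2) with hDdef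
  have eD₂ : heron (ellu I₃ u₂ u₁ ^ 2) (ellu I₁ u₂ u₃ ^ 2) (ellu I₂ u₁ u₃ ^ 2) = D := by
    rw [hDdef, ellu_comm I₃ u₂, heron_rotate]
  have eD₃ : heron (ellu I₂ u₃ u₁ ^ 2) (ellu I₁ u₃ u₂ ^ 2) (ellu I₃ u₁ u₂ ^ 2) = D := by
    rw [hDdef, ellu_comm I₂ u₃, ellu_comm I₁ u₃, heron_rotate, heron_swap]
  have e₁₂ : H₁₂ / ellu I₃ u₁ u₂ = 2 * centerNum I₁ I₂ I₃ (Real.exp u₁) (Real.exp u₂)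
      (Real.exp u₃) / (ellu I₃ u₁ u₂ ^ 2 * Real.sqrt D) := by
    rw [← center_div_eq_centerNum_div p₁ p₂ p₃ q₁₂ hD hA]
    subst_vars
    ring
  have e₁₃ : H₁₃ / ellu I₂ u₁ u₃ = 2 * centerNum I₁ I₃ I₂ (Real.exp u₁) (Real.exp u₃)
      (Real.exp u₂) / (ellu I₂ u₁ u₃ ^ 2 * Real.sqrt D) := by
    rw [← center_div_eq_centerNum_div p₁ p₃ p₂ q₁₃ hD hA]
    subst_vars
    ring
  have e₂₃ : H₂₃ / ellu I₁ u₂ u₃ = 2 * centerNum I₂ I₃ I₁ (Real.exp u₂) (Real.exp u₃)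
      (Real.exp u₁) / (ellu I₁ u₂ u₃ ^ 2 * Real.sqrt D) := by
    rw [← center_div_eq_centerNum_div p₂ p₃ p₁ q₂₃ hD hA]
    subst_vars
    ring
  have hD₂ : 0 < heron (ellu I₃ u₂ u₁ ^ 2) (ellu I₁ u₂ u₃ ^ 2) (ellu I₂ u₁ u₃ ^ 2) := eD₂ ▸ hD
  have hD₃ : 0 < heron (ellu I₂ u₃ u₁ ^ 2) (ellu I₁ u₃ u₂ ^ 2) (ellu I₃ u₁ u₂ ^ 2) := eD₃ ▸ hD
  have d₂₁ := hasDerivAt_theta1_snd hI₂ hI₁ hI₃ hD₂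
  have d₂₂ := hasDerivAt_theta1_fst hI₂ hI₁ hI₃ hD₂
  have d₂₃ := hasDerivAt_theta1_thd hI₂ hI₁ hI₃ hD₂
  have n₂ := neg_centerNum_div_sub_neg hI₂ hI₁ hI₃ hD₂
  have d₃₁ := hasDerivAt_theta1_snd hI₃ hI₁ hI₂ hD₃
  have d₃₃ := hasDerivAt_theta1_fst hI₃ hI₁ hI₂ hD₃
  have d₃₂ := hasDerivAt_theta1_thd hI₃ hI₁ hI₂ hD₃
  have n₃ := neg_centerNum_div_sub_neg hI₃ hI₁ hI₂ hD₃
  rw [eD₂, ellu_comm I₃ u₂, centerNum_swap I₂ I₁ I₃, ← e₁₂] at d₂₁ d₂₂ n₂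
  rw [eD₂, ← e₂₃] at d₂₃
  rw [← e₂₃] at d₂₂ n₂
  rw [eD₃, ellu_comm I₂ u₃, centerNum_swap I₃ I₁ I₂, ← e₁₃] at d₃₁
  rw [eD₃, ellu_comm I₁ u₃, centerNum_swap I₃ I₂ I₁, ← e₂₃] at d₃₂
  rw [eD₃, ellu_comm I₂ u₃, ellu_comm I₁ u₃, centerNum_swap I₃ I₁ I₂, centerNum_swap I₃ I₂ I₁,
    ← e₁₃, ← e₂₃] at d₃₃ n₃
  simp only [theta2_eq_theta1, theta3_eq_theta1]
  refine ⟨⟨?_, ?_, ?_⟩, ⟨?_, d₂₁⟩, ⟨?_, d₃₁⟩, ⟨d₂₃, d₃₂⟩, ⟨?_, ?_⟩, ⟨d₂₂, n₂⟩, d₃₃, n₃⟩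
  · exact differentiableAt_ang (differentiableAt_ellu hI₃ (by fun_prop) (by fun_prop))
      (differentiableAt_ellu hI₂ (by fun_prop) (by fun_prop))
      (differentiableAt_ellu hI₁ (by fun_prop) (by fun_prop)) q₁₂ q₁₃ hD
  · exact differentiableAt_ang (differentiableAt_ellu hI₃ (by fun_prop) (by fun_prop))
      (differentiableAt_ellu hI₁ (by fun_prop) (by fun_prop))
      (differentiableAt_ellu hI₂ (by fun_prop) (by fun_prop)) (ellu_pos hI₃) q₂₃ hD₂
  · exact differentiableAt_ang (differentiableAt_ellu hI₂ (by fun_prop) (by fun_prop))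
      (differentiableAt_ellu hI₁ (by fun_prop) (by fun_prop))
      (differentiableAt_ellu hI₃ (by fun_prop) (by fun_prop)) (ellu_pos hI₂) (ellu_pos hI₁) hD₃
  · rw [e₁₂]; exact hasDerivAt_theta1_snd hI₁ hI₂ hI₃ hD
  · rw [e₁₃]; exact hasDerivAt_theta1_thd hI₁ hI₂ hI₃ hD
  · rw [e₁₂, e₁₃]; exact hasDerivAt_theta1_fst hI₁ hI₂ hI₃ hD
  · rw [e₁₂, e₁₃]; exact neg_centerNum_div_sub_neg hI₁ hI₂ hI₃ hD
end

section
/- If (r₁, r₂, r₃) ∈ ℝ³_{>0} is not admissible (equivalently Q ≤ 0), then exactly one of h₁, h₂, h₃ is negative and the other two are positive. In particular, if (r₁, r₂, r₃) generates a degenerate triangle with flat vertex v₃ (i.e. l₁₂ = l₁₃ + l₂₃), then h₁ > 0, h₂ > 0 and h₃ < 0. -/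
/-- If one of the quantities `h` is negative, any other one is positive. -/
lemma height_pos_of_height_neg {x y z a b c : ℝ} (hy : 0 < y) (hz : 0 < z)
    (ha : 1 < a) (hb : 1 < b) (hc : 1 < c)
    (h : x * (1 - a ^ 2) + y * (c + a * b) + z * (b + a * c) < 0) :
    0 < y * (1 - b ^ 2) + x * (c + a * b) + z * (a + b * c) := by
  have ha' : 0 < a ^ 2 - 1 := by nlinarith
  have hb0 : 0 < b := by linarith
  have hc0 : 0 < c := by linarith
  have ha0 : 0 < a := by linarith
  have hb' : 0 < b ^ 2 - 1 := by nlinarith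
  refine pos_of_mul_pos_right ?_ ha'.le
  have key : (a ^ 2 - 1) * (y * (1 - b ^ 2) + x * (c + a * b) + z * (a + b * c)) =
      -(x * (1 - a ^ 2) + y * (c + a * b) + z * (b + a * c)) * (c + a * b) +
        y * (c ^ 2 + a ^ 2 + (b ^ 2 - 1) + 2 * a * b * c) +
        z * ((b + a * c) * (c + a * b) + (a ^ 2 - 1) * (a + b * c)) := by ring
  rw [key]
  have := neg_pos.2 h
  positivity

/-- A Heron-type expression is nonpositive when the triangle inequalities fail. -/
lemma heron_nonpos {x y z : ℝ} (hx : 0 < x) (hy : 0 < y) (hz : 0 < z)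
    (h : ¬ (x < y + z ∧ y < x + z ∧ z < x + y)) :
    4 * y ^ 2 * z ^ 2 - (y ^ 2 + z ^ 2 - x ^ 2) ^ 2 ≤ 0 := by
  have key : 4 * y ^ 2 * z ^ 2 - (y ^ 2 + z ^ 2 - x ^ 2) ^ 2 =
      (x + y + z) * ((y + z - x) * ((x + z - y) * (x + y - z))) := by ring
  rw [key]
  refine mul_nonpos_of_nonneg_of_nonpos (by positivity) ?_
  rcases le_or_gt (y + z) x with h₁ | h₁
  · exact mul_nonpos_of_nonpos_of_nonneg (by linarith)
      (mul_nonneg (by linarith) (by linarith))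
  refine mul_nonpos_of_nonneg_of_nonpos (by linarith) ?_
  rcases le_or_gt (x + z) y with h₂ | h₂
  · exact mul_nonpos_of_nonpos_of_nonneg (by linarith) (by linarith)
  refine mul_nonpos_of_nonneg_of_nonpos (by linarith) ?_
  by_contra! h₃
  exact h ⟨h₁, h₂, by linarith⟩

/-- If three numbers `p < 0 < q, s` sum to zero and `p ^ 2`, `q ^ 2` are proportional to
`S`, `T`, then `T < S`. -/
lemma lt_of_sq_eq_mul_of_sum_eq_zero {p q s D S T : ℝ} (hD : 0 < D)
    (hp : p ^ 2 = D * S) (hq : q ^ 2 = D * T) (hs : 0 < s) (hq0 : 0 < q)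
    (hsum : p + q + s = 0) : T < S := by
  have h : q ^ 2 < p ^ 2 := by nlinarith
  rw [hp, hq] at h
  exact lt_of_mul_lt_mul_left h hD.le

/-- Completing the square in the quadratic form `Q` with respect to one variable. -/
lemma height_sq (x y z a b c : ℝ) :
    (x * (1 - a ^ 2) + y * (c + a * b) + z * (b + a * c)) ^ 2 =
      (1 - a ^ 2) * (x * (x * (1 - a ^ 2) + y * (c + a * b) + z * (b + a * c)) +
        y * (y * (1 - b ^ 2) + x * (c + a * b) + z * (a + b * c)) +
        z * (z * (1 - c ^ 2) + x * (b + a * c) + y * (a + b * c))) +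
      (a ^ 2 + b ^ 2 + c ^ 2 + 2 * a * b * c - 1) * (y ^ 2 + z ^ 2 + 2 * y * z * a) := by
  ring

/-- Lemma 2.4(b): if `(r₁, r₂, r₃) ∈ ℝ³_{>0}` is not admissible, then exactly one
of `h₁, h₂, h₃` is negative and the other two are positive; in particular for a
degenerate triangle with flat vertex `v₃` one has `h₁ > 0, h₂ > 0, h₃ < 0`. -/
theorem stmt_4 (r₁ r₂ r₃ I₁ I₂ I₃ l₁₂ l₁₃ l₂₃ κ₁ κ₂ κ₃ γ₁ γ₂ γ₃ h₁ h₂ h₃ : ℝ)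
    (hr₁ : 0 < r₁) (hr₂ : 0 < r₂) (hr₃ : 0 < r₃)
    (hI₁ : 1 < I₁) (hI₂ : 1 < I₂) (hI₃ : 1 < I₃)
    (hl₁₂ : l₁₂ = Real.sqrt (r₁ ^ 2 + r₂ ^ 2 + 2 * r₁ * r₂ * I₃))
    (hl₁₃ : l₁₃ = Real.sqrt (r₁ ^ 2 + r₃ ^ 2 + 2 * r₁ * r₃ * I₂))
    (hl₂₃ : l₂₃ = Real.sqrt (r₂ ^ 2 + r₃ ^ 2 + 2 * r₂ * r₃ * I₁))
    (hκ₁ : κ₁ = 1 / r₁) (hκ₂ : κ₂ = 1 / r₂) (hκ₃ : κ₃ = 1 / r₃)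
    (hγ₁ : γ₁ = I₁ + I₂ * I₃) (hγ₂ : γ₂ = I₂ + I₁ * I₃) (hγ₃ : γ₃ = I₃ + I₁ * I₂)
    (hh₁ : h₁ = κ₁ * (1 - I₁ ^ 2) + κ₂ * γ₃ + κ₃ * γ₂)
    (hh₂ : h₂ = κ₂ * (1 - I₂ ^ 2) + κ₁ * γ₃ + κ₃ * γ₁)
    (hh₃ : h₃ = κ₃ * (1 - I₃ ^ 2) + κ₁ * γ₂ + κ₂ * γ₁)
    (hnadm : ¬ (l₁₂ < l₁₃ + l₂₃ ∧ l₁₃ < l₁₂ + l₂₃ ∧ l₂₃ < l₁₂ + l₁₃)) :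
    ((h₁ < 0 ∧ 0 < h₂ ∧ 0 < h₃) ∨ (0 < h₁ ∧ h₂ < 0 ∧ 0 < h₃) ∨
      (0 < h₁ ∧ 0 < h₂ ∧ h₃ < 0)) ∧
    (l₁₂ = l₁₃ + l₂₃ → 0 < h₁ ∧ 0 < h₂ ∧ h₃ < 0) := by
  have hI₁0 : 0 < I₁ := by linarith
  have hI₂0 : 0 < I₂ := by linarith
  have hI₃0 : 0 < I₃ := by linarith
  have hk₁ : 0 < κ₁ := by rw [hκ₁]; positivity
  have hk₂ : 0 < κ₂ := by rw [hκ₂]; positivity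
  have hk₃ : 0 < κ₃ := by rw [hκ₃]; positivity
  have hp₁₂ : 0 < l₁₂ := by rw [hl₁₂]; positivity
  have hp₁₃ : 0 < l₁₃ := by rw [hl₁₃]; positivity
  have hp₂₃ : 0 < l₂₃ := by rw [hl₂₃]; positivity
  have hs₁₂ : l₁₂ ^ 2 = r₁ ^ 2 + r₂ ^ 2 + 2 * r₁ * r₂ * I₃ := by
    rw [hl₁₂, Real.sq_sqrt (by positivity)]
  have hs₁₃ : l₁₃ ^ 2 = r₁ ^ 2 + r₃ ^ 2 + 2 * r₁ * r₃ * I₂ := by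
    rw [hl₁₃, Real.sq_sqrt (by positivity)]
  have hs₂₃ : l₂₃ ^ 2 = r₂ ^ 2 + r₃ ^ 2 + 2 * r₂ * r₃ * I₁ := by
    rw [hl₂₃, Real.sq_sqrt (by positivity)]
  obtain ⟨Q, hQ⟩ : ∃ Q, Q = κ₁ * h₁ + κ₂ * h₂ + κ₃ * h₃ := ⟨_, rfl⟩
  have heron : 4 * l₁₃ ^ 2 * l₂₃ ^ 2 - (l₁₃ ^ 2 + l₂₃ ^ 2 - l₁₂ ^ 2) ^ 2 =
      4 * (r₁ * r₂ * r₃) ^ 2 * Q := by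
    rw [hs₁₂, hs₁₃, hs₂₃, hQ, hh₁, hh₂, hh₃, hγ₁, hγ₂, hγ₃, hκ₁, hκ₂, hκ₃]
    field_simp
    ring
  have hQ0 : Q ≤ 0 := by
    have h := heron_nonpos hp₁₂ hp₁₃ hp₂₃ hnadm
    rw [heron] at h
    exact nonpos_of_mul_nonpos_right h (by positivity)
  obtain ⟨D, hDdef⟩ : ∃ D, D = I₁ ^ 2 + I₂ ^ 2 + I₃ ^ 2 + 2 * I₁ * I₂ * I₃ - 1 := ⟨_, rfl⟩
  have hD : 0 < D := by
    rw [hDdef]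
    have h : 0 < I₂ ^ 2 + I₃ ^ 2 + 2 * I₁ * I₂ * I₃ := by positivity
    linarith [one_lt_pow₀ hI₁ two_ne_zero]
  have hq₁ : h₁ ^ 2 = (1 - I₁ ^ 2) * Q + D * (κ₂ * κ₃ * l₂₃) ^ 2 := by
    have e : (κ₂ * κ₃ * l₂₃) ^ 2 = κ₂ ^ 2 + κ₃ ^ 2 + 2 * κ₂ * κ₃ * I₁ := by
      rw [mul_pow, hs₂₃, hκ₂, hκ₃]; field_simp; ring
    rw [e, hDdef, hQ, hh₁, hh₂, hh₃, hγ₁, hγ₂, hγ₃]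
    linear_combination height_sq κ₁ κ₂ κ₃ I₁ I₂ I₃
  have hq₂ : h₂ ^ 2 = (1 - I₂ ^ 2) * Q + D * (κ₁ * κ₃ * l₁₃) ^ 2 := by
    have e : (κ₁ * κ₃ * l₁₃) ^ 2 = κ₁ ^ 2 + κ₃ ^ 2 + 2 * κ₁ * κ₃ * I₂ := by
      rw [mul_pow, hs₁₃, hκ₁, hκ₃]; field_simp; ring
    rw [e, hDdef, hQ, hh₁, hh₂, hh₃, hγ₁, hγ₂, hγ₃]
    linear_combination height_sq κ₂ κ₁ κ₃ I₂ I₁ I₃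
  have hq₃ : h₃ ^ 2 = (1 - I₃ ^ 2) * Q + D * (κ₁ * κ₂ * l₁₂) ^ 2 := by
    have e : (κ₁ * κ₂ * l₁₂) ^ 2 = κ₁ ^ 2 + κ₂ ^ 2 + 2 * κ₁ * κ₂ * I₃ := by
      rw [mul_pow, hs₁₂, hκ₁, hκ₂]; field_simp; ring
    rw [e, hDdef, hQ, hh₁, hh₂, hh₃, hγ₁, hγ₂, hγ₃]
    linear_combination height_sq κ₃ κ₁ κ₂ I₃ I₁ I₂
  have ne_zero {h I t : ℝ} (hI : 1 < I) (ht : 0 < t)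
      (hq : h ^ 2 = (1 - I ^ 2) * Q + D * t ^ 2) : h ≠ 0 := by
    have h₁ : 0 ≤ (1 - I ^ 2) * Q :=
      mul_nonneg_of_nonpos_of_nonpos (by linarith [one_lt_pow₀ hI two_ne_zero]) hQ0
    have h₂ : 0 < D * t ^ 2 := by positivity
    exact fun h0 => by rw [h0] at hq; linarith
  have hn₁ : h₁ ≠ 0 := ne_zero hI₁ (by positivity) hq₁
  have hn₂ : h₂ ≠ 0 := ne_zero hI₂ (by positivity) hq₂
  have hn₃ : h₃ ≠ 0 := ne_zero hI₃ (by positivity) hq₃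
  have neg₁ (h : h₁ < 0) : 0 < h₂ ∧ 0 < h₃ := by
    subst hh₁ hh₂ hh₃ hγ₁ hγ₂ hγ₃
    constructor
    · linarith [height_pos_of_height_neg (x := κ₁) hk₂ hk₃ hI₁ hI₂ hI₃ (by linarith)]
    · linarith [height_pos_of_height_neg (x := κ₁) hk₃ hk₂ hI₁ hI₃ hI₂ (by linarith)]
  have neg₂ (h : h₂ < 0) : 0 < h₁ ∧ 0 < h₃ := by
    subst hh₁ hh₂ hh₃ hγ₁ hγ₂ hγ₃
    constructor
    · linarith [height_pos_of_height_neg (x := κ₂) hk₁ hk₃ hI₂ hI₁ hI₃ (by linarith)]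
    · linarith [height_pos_of_height_neg (x := κ₂) hk₃ hk₁ hI₂ hI₃ hI₁ (by linarith)]
  have neg₃ (h : h₃ < 0) : 0 < h₁ ∧ 0 < h₂ := by
    subst hh₁ hh₂ hh₃ hγ₁ hγ₂ hγ₃
    constructor
    · linarith [height_pos_of_height_neg (x := κ₃) hk₁ hk₂ hI₃ hI₁ hI₂ (by linarith)]
    · linarith [height_pos_of_height_neg (x := κ₃) hk₂ hk₁ hI₃ hI₂ hI₁ (by linarith)]
  have main : (h₁ < 0 ∧ 0 < h₂ ∧ 0 < h₃) ∨ (0 < h₁ ∧ h₂ < 0 ∧ 0 < h₃) ∨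
      (0 < h₁ ∧ 0 < h₂ ∧ h₃ < 0) := by
    rcases hn₁.lt_or_gt with a | a
    · exact .inl ⟨a, neg₁ a⟩
    rcases hn₂.lt_or_gt with b | b
    · exact .inr (.inl ⟨a, b, (neg₂ b).2⟩)
    rcases hn₃.lt_or_gt with c | c
    · exact .inr (.inr ⟨a, b, c⟩)
    · have : 0 < Q := by rw [hQ]; positivity
      linarith
  refine ⟨main, fun hflat => ?_⟩
  have hQz : Q = 0 := by
    have h : 4 * (r₁ * r₂ * r₃) ^ 2 * Q = 0 := by rw [← heron, hflat]; ring
    exact (mul_eq_zero.1 h).resolve_left (by positivity)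
  have hsum : κ₁ * h₁ + κ₂ * h₂ + κ₃ * h₃ = 0 := hQ ▸ hQz
  rw [hQz] at hq₁ hq₂ hq₃
  have hE : 0 < D * (κ₁ * κ₂ * κ₃) ^ 2 := by positivity
  have hw₁ : (κ₁ * h₁) ^ 2 = D * (κ₁ * κ₂ * κ₃) ^ 2 * l₂₃ ^ 2 := by
    linear_combination κ₁ ^ 2 * hq₁
  have hw₂ : (κ₂ * h₂) ^ 2 = D * (κ₁ * κ₂ * κ₃) ^ 2 * l₁₃ ^ 2 := by
    linear_combination κ₂ ^ 2 * hq₂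
  have hw₃ : (κ₃ * h₃) ^ 2 = D * (κ₁ * κ₂ * κ₃) ^ 2 * l₁₂ ^ 2 := by
    linear_combination κ₃ ^ 2 * hq₃
  rcases main with ⟨-, b, c⟩ | ⟨a, -, c⟩ | h
  · have hlt := lt_of_sq_eq_mul_of_sum_eq_zero hE hw₁ hw₃ (mul_pos hk₂ b) (mul_pos hk₃ c)
      (by linarith)
    linarith [lt_of_pow_lt_pow_left₀ 2 (by positivity) hlt]
  · have hlt := lt_of_sq_eq_mul_of_sum_eq_zero hE hw₂ hw₃ (mul_pos hk₁ a) (mul_pos hk₃ c)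
      (by linarith)
    linarith [lt_of_pow_lt_pow_left₀ 2 (by positivity) hlt]
  · exact h
end

section
/- Suppose (r̄₁, r̄₂, r̄₃) ∈ ℝ³_{>0} generates a degenerate triangle with flat vertex v₃ (i.e. l₁₂ = l₁₃ + l₂₃). Then as admissible triples (r̃₁, r̃₂, r̃₃) tend to (r̄₁, r̄₂, r̄₃), one has h̃_{12,3} → −∞, h̃_{13,2} → +∞, and h̃_{23,1} → +∞, where the tilde quantities are computed at (r̃₁, r̃₂, r̃₃). -/
/-- Inversive distance edge length for radii `a, b` and weight `I` on the edge. -/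
noncomputable def lenr (I a b : ℝ) : ℝ :=
  Real.sqrt (a ^ 2 + b ^ 2 + 2 * a * b * I)

/-- Length `l₁₂` of the triple `p = (r₁, r₂, r₃)` (weight `I₃` on the edge `v₁v₂`). -/
noncomputable def l12 (I₃ : ℝ) (p : ℝ × ℝ × ℝ) : ℝ := lenr I₃ p.1 p.2.1

/-- Length `l₁₃` of the triple `p = (r₁, r₂, r₃)` (weight `I₂` on the edge `v₁v₃`). -/
noncomputable def l13 (I₂ : ℝ) (p : ℝ × ℝ × ℝ) : ℝ := lenr I₂ p.1 p.2.2

/-- Length `l₂₃` of the triple `p = (r₁, r₂, r₃)` (weight `I₁` on the edge `v₂v₃`). -/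
noncomputable def l23 (I₁ : ℝ) (p : ℝ × ℝ × ℝ) : ℝ := lenr I₁ p.2.1 p.2.2

/-- The admissible space: positive triples whose induced lengths satisfy the
strict triangle inequalities. -/
def admSet (I₁ I₂ I₃ : ℝ) : Set (ℝ × ℝ × ℝ) :=
  {p | 0 < p.1 ∧ 0 < p.2.1 ∧ 0 < p.2.2 ∧
    l12 I₃ p < l13 I₂ p + l23 I₁ p ∧
    l13 I₂ p < l12 I₃ p + l23 I₁ p ∧
    l23 I₁ p < l12 I₃ p + l13 I₂ p}

/-- Inner angle `θ₁` at the vertex `v₁`. -/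
noncomputable def theta1' (I₁ I₂ I₃ : ℝ) (p : ℝ × ℝ × ℝ) : ℝ :=
  Real.arccos ((l12 I₃ p ^ 2 + l13 I₂ p ^ 2 - l23 I₁ p ^ 2) / (2 * l12 I₃ p * l13 I₂ p))

/-- `A = l₁₂ l₁₃ sin θ₁`. -/
noncomputable def areaA (I₁ I₂ I₃ : ℝ) (p : ℝ × ℝ × ℝ) : ℝ :=
  l12 I₃ p * l13 I₂ p * Real.sin (theta1' I₁ I₂ I₃ p)

/-- `h₃ = κ₃(1 − I₃²) + κ₁γ₂ + κ₂γ₁`. -/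
noncomputable def hfun3 (I₁ I₂ I₃ : ℝ) (p : ℝ × ℝ × ℝ) : ℝ :=
  (1 / p.2.2) * (1 - I₃ ^ 2) + (1 / p.1) * (I₂ + I₁ * I₃) + (1 / p.2.1) * (I₁ + I₂ * I₃)

/-- `h₂ = κ₂(1 − I₂²) + κ₁γ₃ + κ₃γ₁`. -/
noncomputable def hfun2 (I₁ I₂ I₃ : ℝ) (p : ℝ × ℝ × ℝ) : ℝ :=
  (1 / p.2.1) * (1 - I₂ ^ 2) + (1 / p.1) * (I₃ + I₁ * I₂) + (1 / p.2.2) * (I₁ + I₂ * I₃)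

/-- `h₁ = κ₁(1 − I₁²) + κ₂γ₃ + κ₃γ₂`. -/
noncomputable def hfun1 (I₁ I₂ I₃ : ℝ) (p : ℝ × ℝ × ℝ) : ℝ :=
  (1 / p.1) * (1 - I₁ ^ 2) + (1 / p.2.1) * (I₃ + I₁ * I₂) + (1 / p.2.2) * (I₂ + I₁ * I₃)

/-- `h₁₂,₃ = r₁²r₂²r₃² κ₃ h₃ / (A l₁₂)`. -/
noncomputable def H123 (I₁ I₂ I₃ : ℝ) (p : ℝ × ℝ × ℝ) : ℝ :=
  p.1 ^ 2 * p.2.1 ^ 2 * p.2.2 ^ 2 * ((1 / p.2.2) * hfun3 I₁ I₂ I₃ p) /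
    (areaA I₁ I₂ I₃ p * l12 I₃ p)

/-- `h₁₃,₂ = r₁²r₂²r₃² κ₂ h₂ / (A l₁₃)`. -/
noncomputable def H132 (I₁ I₂ I₃ : ℝ) (p : ℝ × ℝ × ℝ) : ℝ :=
  p.1 ^ 2 * p.2.1 ^ 2 * p.2.2 ^ 2 * ((1 / p.2.1) * hfun2 I₁ I₂ I₃ p) /
    (areaA I₁ I₂ I₃ p * l13 I₂ p)

/-- `h₂₃,₁ = r₁²r₂²r₃² κ₁ h₁ / (A l₂₃)`. -/
noncomputable def H231 (I₁ I₂ I₃ : ℝ) (p : ℝ × ℝ × ℝ) : ℝ :=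
  p.1 ^ 2 * p.2.1 ^ 2 * p.2.2 ^ 2 * ((1 / p.1) * hfun1 I₁ I₂ I₃ p) /
    (areaA I₁ I₂ I₃ p * l23 I₁ p)

theorem lenr_pos {I a b : ℝ} (hI : 1 < I) (ha : 0 < a) (hb : 0 < b) : 0 < lenr I a b :=
  Real.sqrt_pos.2 (by positivity)

theorem lenr_sq {I a b : ℝ} (hI : 1 < I) (ha : 0 < a) (hb : 0 < b) :
    lenr I a b ^ 2 = a ^ 2 + b ^ 2 + 2 * a * b * I :=
  Real.sq_sqrt (by positivity)

theorem continuous_l12 (I : ℝ) : Continuous (l12 I) := by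
  unfold l12 lenr; fun_prop

theorem continuous_l13 (I : ℝ) : Continuous (l13 I) := by
  unfold l13 lenr; fun_prop

theorem continuous_l23 (I : ℝ) : Continuous (l23 I) := by
  unfold l23 lenr; fun_prop

theorem sin_arccos_cosine_law_pos {a b c : ℝ} (hb : 0 < b) (hc : 0 < c)
    (h₁ : c < b + a) (h₂ : b < c + a) (h₃ : a < c + b) :
    0 < Real.sin (Real.arccos ((c ^ 2 + b ^ 2 - a ^ 2) / (2 * c * b))) := by
  rw [Real.sin_arccos, Real.sqrt_pos, sub_pos, sq_lt_one_iff_abs_lt_one, abs_lt]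
  have ha : 0 < a := by linarith
  constructor
  · rw [lt_div_iff₀ (by positivity)]
    nlinarith [mul_pos (sub_pos.2 h₃) (by positivity : 0 < a + c + b)]
  · rw [div_lt_one (by positivity)]
    nlinarith [mul_pos (sub_pos.2 h₁) (sub_pos.2 h₂)]

theorem areaA_pos {I₁ I₂ I₃ : ℝ} (hI₂ : 1 < I₂) (hI₃ : 1 < I₃)
    {p : ℝ × ℝ × ℝ} (hp : p ∈ admSet I₁ I₂ I₃) : 0 < areaA I₁ I₂ I₃ p := by
  obtain ⟨h₁, h₂, h₃, t₁, t₂, t₃⟩ := hp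
  have hc : 0 < l12 I₃ p := lenr_pos hI₃ h₁ h₂
  have hb : 0 < l13 I₂ p := lenr_pos hI₂ h₁ h₃
  exact mul_pos (mul_pos hc hb) (sin_arccos_cosine_law_pos hb hc t₁ t₂ t₃)

theorem areaA_eq_zero_of_flat {I₁ I₂ I₃ : ℝ} {p : ℝ × ℝ × ℝ}
    (hdeg : l12 I₃ p = l13 I₂ p + l23 I₁ p) : areaA I₁ I₂ I₃ p = 0 := by
  unfold areaA theta1'
  by_cases h : l12 I₃ p * l13 I₂ p = 0
  · rw [h, zero_mul]
  · have : (l12 I₃ p ^ 2 + l13 I₂ p ^ 2 - l23 I₁ p ^ 2) / (2 * l12 I₃ p * l13 I₂ p) = 1 := by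
      rw [div_eq_one_iff_eq (by simpa [mul_assoc] using h),
        show l23 I₁ p = l12 I₃ p - l13 I₂ p by linarith]
      ring
    rw [this, Real.arccos_one, Real.sin_zero, mul_zero]

theorem continuousAt_areaA {I₁ I₂ I₃ : ℝ} {p : ℝ × ℝ × ℝ}
    (hc : l12 I₃ p ≠ 0) (hb : l13 I₂ p ≠ 0) : ContinuousAt (areaA I₁ I₂ I₃) p := by
  have c₁ := (continuous_l12 I₃).continuousAt (x := p)
  have c₂ := (continuous_l13 I₂).continuousAt (x := p)
  have c₃ := (continuous_l23 I₁).continuousAt (x := p)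
  have hq : ContinuousAt (fun q => (l12 I₃ q ^ 2 + l13 I₂ q ^ 2 - l23 I₁ q ^ 2) /
      (2 * l12 I₃ q * l13 I₂ q)) p :=
    (((c₁.pow 2).add (c₂.pow 2)).sub (c₃.pow 2)).div ((c₁.const_mul 2).mul c₂) (by simp [hc, hb])
  exact (c₁.mul c₂).mul
    (Real.continuous_sin.continuousAt.comp (Real.continuous_arccos.continuousAt.comp hq))

/-- If `A = 0` with flat vertex `v₃`, then `(h₁, h₂, h₃)` is a positive multiple of
`(a r₁, b r₂, -c r₃)`, where `a, b, c` are the lengths opposite `v₁, v₂, v₃`. -/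
theorem hfun_signs_of_flat {I₁ I₂ I₃ r₁ r₂ r₃ : ℝ}
    (hI₁ : 1 < I₁) (hI₂ : 1 < I₂) (hI₃ : 1 < I₃) (hr₁ : 0 < r₁) (hr₂ : 0 < r₂) (hr₃ : 0 < r₃)
    (hdeg : l12 I₃ (r₁, r₂, r₃) = l13 I₂ (r₁, r₂, r₃) + l23 I₁ (r₁, r₂, r₃)) :
    hfun3 I₁ I₂ I₃ (r₁, r₂, r₃) < 0 ∧ 0 < hfun2 I₁ I₂ I₃ (r₁, r₂, r₃) ∧
      0 < hfun1 I₁ I₂ I₃ (r₁, r₂, r₃) := by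
  simp only [l12, l13, l23] at hdeg
  have hc := lenr_sq hI₃ hr₁ hr₂
  have hb := lenr_sq hI₂ hr₁ hr₃
  have ha := lenr_sq hI₁ hr₂ hr₃
  have b0 := lenr_pos hI₂ hr₁ hr₃
  have a0 := lenr_pos hI₁ hr₂ hr₃
  rw [hdeg] at hc
  clear hdeg
  generalize lenr I₂ r₁ r₃ = b at *
  generalize lenr I₁ r₂ r₃ = a at *
  set T := r₃ * (I₂ * a * r₁ + I₁ * b * r₂ + (a + b) * r₃) with hT
  have T0 : 0 < T := by positivity
  have e₁ : T * (1 / r₁) = -a * r₁ + I₃ * b * r₂ - I₂ * (a + b) * r₃ := by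
    rw [mul_one_div, div_eq_iff hr₁.ne', hT]
    linear_combination b / 2 * hc - (a + b + a) / 2 * hb - b / 2 * ha
  have e₂ : T * (1 / r₂) = I₃ * a * r₁ - b * r₂ - I₁ * (a + b) * r₃ := by
    rw [mul_one_div, div_eq_iff hr₂.ne', hT]
    linear_combination a / 2 * hc - (a + b + b) / 2 * ha - a / 2 * hb
  have e₃ : T * (1 / r₃) = I₂ * a * r₁ + I₁ * b * r₂ + (a + b) * r₃ := by
    rw [mul_one_div, div_eq_iff hr₃.ne', hT]
    ring
  have D0 : 0 < I₁ ^ 2 + I₂ ^ 2 + I₃ ^ 2 + 2 * I₁ * I₂ * I₃ - 1 := by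
    have : 0 < I₁ * I₂ * I₃ := by positivity
    nlinarith
  set D := I₁ ^ 2 + I₂ ^ 2 + I₃ ^ 2 + 2 * I₁ * I₂ * I₃ - 1
  simp only [hfun1, hfun2, hfun3]
  refine ⟨neg_of_mul_neg_right (a := T) ?_ T0.le, pos_of_mul_pos_right (a := T) ?_ T0.le,
    pos_of_mul_pos_right (a := T) ?_ T0.le⟩
  · have : 0 < D * ((a + b) * r₃) := by positivity
    linear_combination this + (1 - I₃ ^ 2) * e₃ + (I₂ + I₁ * I₃) * e₁ + (I₁ + I₂ * I₃) * e₂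
  · have : 0 < D * (b * r₂) := by positivity
    linear_combination this - (1 - I₂ ^ 2) * e₂ - (I₃ + I₁ * I₂) * e₁ - (I₁ + I₂ * I₃) * e₃
  · have : 0 < D * (a * r₁) := by positivity
    linear_combination this - (1 - I₁ ^ 2) * e₁ - (I₃ + I₁ * I₂) * e₂ - (I₂ + I₁ * I₃) * e₃

/-- Lemma 2.4(b), limits: as admissible triples tend to a degenerate triple with
flat vertex `v₃`, one has `h₁₂,₃ → −∞`, `h₁₃,₂ → +∞`, `h₂₃,₁ → +∞`. -/
theorem stmt_5 (I₁ I₂ I₃ rb₁ rb₂ rb₃ : ℝ)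
    (hI₁ : 1 < I₁) (hI₂ : 1 < I₂) (hI₃ : 1 < I₃)
    (hr₁ : 0 < rb₁) (hr₂ : 0 < rb₂) (hr₃ : 0 < rb₃)
    (hdeg : l12 I₃ (rb₁, rb₂, rb₃) = l13 I₂ (rb₁, rb₂, rb₃) + l23 I₁ (rb₁, rb₂, rb₃)) :
    Filter.Tendsto (H123 I₁ I₂ I₃)
      (nhdsWithin ((rb₁, rb₂, rb₃) : ℝ × ℝ × ℝ) (admSet I₁ I₂ I₃)) Filter.atBot ∧
    Filter.Tendsto (H132 I₁ I₂ I₃)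
      (nhdsWithin ((rb₁, rb₂, rb₃) : ℝ × ℝ × ℝ) (admSet I₁ I₂ I₃)) Filter.atTop ∧
    Filter.Tendsto (H231 I₁ I₂ I₃)
      (nhdsWithin ((rb₁, rb₂, rb₃) : ℝ × ℝ × ℝ) (admSet I₁ I₂ I₃)) Filter.atTop := by
  set p : ℝ × ℝ × ℝ := (rb₁, rb₂, rb₃)
  have hc : 0 < l12 I₃ p := lenr_pos hI₃ hr₁ hr₂
  have hb : 0 < l13 I₂ p := lenr_pos hI₂ hr₁ hr₃
  obtain ⟨s₃, s₂, s₁⟩ := hfun_signs_of_flat hI₁ hI₂ hI₃ hr₁ hr₂ hr₃ hdeg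
  have inv_tendsto : ∀ l : ℝ × ℝ × ℝ → ℝ, Continuous l → (∀ q ∈ admSet I₁ I₂ I₃, 0 < l q) →
      Filter.Tendsto (fun q => (areaA I₁ I₂ I₃ q * l q)⁻¹)
        (nhdsWithin p (admSet I₁ I₂ I₃)) Filter.atTop := by
    intro l hl hpos
    refine tendsto_inv_nhdsGT_zero.comp (tendsto_nhdsWithin_iff.2 ⟨?_, ?_⟩)
    · have := (((continuousAt_areaA (I₁ := I₁) hc.ne' hb.ne').mul hl.continuousAt).tendsto).mono_left
        (nhdsWithin_le_nhds (s := admSet I₁ I₂ I₃))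
      rwa [Pi.mul_apply, areaA_eq_zero_of_flat hdeg, zero_mul] at this
    · filter_upwards [self_mem_nhdsWithin] with q hq
      exact mul_pos (areaA_pos hI₂ hI₃ hq) (hpos q hq)
  have k₁ : ContinuousAt (fun q : ℝ × ℝ × ℝ => 1 / q.1) p :=
    continuousAt_const.div continuousAt_fst hr₁.ne'
  have k₂ : ContinuousAt (fun q : ℝ × ℝ × ℝ => 1 / q.2.1) p :=
    continuousAt_const.div (by fun_prop) hr₂.ne'
  have k₃ : ContinuousAt (fun q : ℝ × ℝ × ℝ => 1 / q.2.2) p :=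
    continuousAt_const.div (by fun_prop) hr₃.ne'
  have n₃ : ContinuousAt (fun q : ℝ × ℝ × ℝ =>
      q.1 ^ 2 * q.2.1 ^ 2 * q.2.2 ^ 2 * ((1 / q.2.2) * hfun3 I₁ I₂ I₃ q)) p := by
    unfold hfun3; fun_prop
  have n₂ : ContinuousAt (fun q : ℝ × ℝ × ℝ =>
      q.1 ^ 2 * q.2.1 ^ 2 * q.2.2 ^ 2 * ((1 / q.2.1) * hfun2 I₁ I₂ I₃ q)) p := by
    unfold hfun2; fun_prop
  have n₁ : ContinuousAt (fun q : ℝ × ℝ × ℝ =>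
      q.1 ^ 2 * q.2.1 ^ 2 * q.2.2 ^ 2 * ((1 / q.1) * hfun1 I₁ I₂ I₃ q)) p := by
    unfold hfun1; fun_prop
  refine ⟨?_, ?_, ?_⟩
  · exact (n₃.tendsto.mono_left nhdsWithin_le_nhds).neg_mul_atTop
      (mul_neg_of_pos_of_neg (by positivity) (mul_neg_of_pos_of_neg (by positivity) s₃))
      (inv_tendsto _ (continuous_l12 I₃) fun q hq => lenr_pos hI₃ hq.1 hq.2.1)
  · exact (n₂.tendsto.mono_left nhdsWithin_le_nhds).pos_mul_atTop
      (mul_pos (by positivity) (mul_pos (by positivity) s₂))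
      (inv_tendsto _ (continuous_l13 I₂) fun q hq => lenr_pos hI₂ hq.1 hq.2.2.1)
  · exact (n₁.tendsto.mono_left nhdsWithin_le_nhds).pos_mul_atTop
      (mul_pos (by positivity) (mul_pos (by positivity) s₁))
      (inv_tendsto _ (continuous_l23 I₁) fun q hq => lenr_pos hI₁ hq.2.1 hq.2.2.1)
end

section
/- Let (r₁, r₂, r₃) be an admissible triple with inner angle θ_i ∈ (0, π) at v_i, and set d_{ij} = (r_i² + r_i r_j I_k)/l_{ij} > 0. Defining the Glickenstein signed distances h_{ij,k} = (d_{ik} − d_{ij} cos θ_i)/sin θ_i and h_{ik,j} = (d_{ij} − d_{ik} cos θ_i)/sin θ_i, the signed angles θ_{ij,k} = arctan(h_{ij,k}/d_{ij}) and θ_{ik,j} = arctan(h_{ik,j}/d_{ik}) satisfy θ_{ij,k} + θ_{ik,j} = θ_i. -/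
/-- If `a, b > 0` are the signed distances from a point to the feet of the perpendiculars it
drops on the sides of an angle `θ ∈ (0, π)`, measured along the sides from the vertex, then the two
signed angles at the vertex add up to `θ`. -/
theorem arctan_add_arctan_eq_angle {a b θ : ℝ} (ha : 0 < a) (hb : 0 < b)
    (h0 : 0 < θ) (hπ : θ < Real.pi) :
    Real.arctan ((b - a * Real.cos θ) / Real.sin θ / a) +
      Real.arctan ((a - b * Real.cos θ) / Real.sin θ / b) = θ := by
  have hs : 0 < Real.sin θ := Real.sin_pos_of_pos_of_lt_pi h0 hπ
  set t := (b - a * Real.cos θ) / Real.sin θ / a with ht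
  have hcα : 0 < Real.cos (Real.arctan t) := Real.cos_arctan_pos t
  have hsα : Real.sin (Real.arctan t) = t * Real.cos (Real.arctan t) := by
    rw [← Real.tan_mul_cos hcα.ne', Real.tan_arctan]
  have hcos : Real.cos (θ - Real.arctan t) = b / a * Real.cos (Real.arctan t) := by
    rw [Real.cos_sub, hsα, ht]
    field_simp
    ring
  have hsin : Real.sin (θ - Real.arctan t) =
      (a - b * Real.cos θ) / (a * Real.sin θ) * Real.cos (Real.arctan t) := by
    rw [Real.sin_sub, hsα, ht]
    field_simp
    linear_combination a * Real.sin_sq_add_cos_sq θ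
  have hpos : 0 < Real.cos (θ - Real.arctan t) := hcos ▸ by positivity
  have hlt := Real.arctan_lt_pi_div_two t
  have hgt := Real.neg_pi_div_two_lt_arctan t
  have hub : θ - Real.arctan t < Real.pi / 2 := by
    by_contra! h
    exact hpos.not_ge (Real.cos_nonpos_of_pi_div_two_le_of_le h (by linarith))
  have htan : Real.tan (θ - Real.arctan t) = (a - b * Real.cos θ) / Real.sin θ / b := by
    rw [Real.tan_eq_sin_div_cos, hcos, hsin]
    field_simp
  rw [← htan, Real.arctan_tan (by linarith) hub]
  ring


/-- Lemma 2.8 / equation (2.12) at the vertex `v₁` (indices `i=1, j=2, k=3`):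
for an admissible triple, the signed angles of the geometric center satisfy
`θ₁₂,₃ + θ₁₃,₂ = θ₁`, where `d₁₂, d₁₃ > 0`. -/
theorem stmt_8 (r₁ r₂ r₃ I₁ I₂ I₃ l₁₂ l₁₃ l₂₃ θ₁ d₁₂ d₁₃ h₁₂₃ h₁₃₂ : ℝ)
    (hr₁ : 0 < r₁) (hr₂ : 0 < r₂) (hr₃ : 0 < r₃)
    (hI₁ : 1 < I₁) (hI₂ : 1 < I₂) (hI₃ : 1 < I₃)
    (hl₁₂ : l₁₂ = Real.sqrt (r₁ ^ 2 + r₂ ^ 2 + 2 * r₁ * r₂ * I₃))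
    (hl₁₃ : l₁₃ = Real.sqrt (r₁ ^ 2 + r₃ ^ 2 + 2 * r₁ * r₃ * I₂))
    (hl₂₃ : l₂₃ = Real.sqrt (r₂ ^ 2 + r₃ ^ 2 + 2 * r₂ * r₃ * I₁))
    (hadm : l₁₂ < l₁₃ + l₂₃ ∧ l₁₃ < l₁₂ + l₂₃ ∧ l₂₃ < l₁₂ + l₁₃)
    (hθ₁ : θ₁ = Real.arccos ((l₁₂ ^ 2 + l₁₃ ^ 2 - l₂₃ ^ 2) / (2 * l₁₂ * l₁₃)))
    (hd₁₂ : d₁₂ = (r₁ ^ 2 + r₁ * r₂ * I₃) / l₁₂)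
    (hd₁₃ : d₁₃ = (r₁ ^ 2 + r₁ * r₃ * I₂) / l₁₃)
    (hh₁₂₃ : h₁₂₃ = (d₁₃ - d₁₂ * Real.cos θ₁) / Real.sin θ₁)
    (hh₁₃₂ : h₁₃₂ = (d₁₂ - d₁₃ * Real.cos θ₁) / Real.sin θ₁) :
    0 < d₁₂ ∧ 0 < d₁₃ ∧
    Real.arctan (h₁₂₃ / d₁₂) + Real.arctan (h₁₃₂ / d₁₃) = θ₁ := by
  have hI₃' : 0 < I₃ := by linarith
  have hI₂' : 0 < I₂ := by linarith
  have hp : 0 < l₁₂ := hl₁₂ ▸ Real.sqrt_pos.2 (by positivity)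
  have hq : 0 < l₁₃ := hl₁₃ ▸ Real.sqrt_pos.2 (by positivity)
  have hd : 0 < d₁₂ := hd₁₂ ▸ by positivity
  have hd' : 0 < d₁₃ := hd₁₃ ▸ by positivity
  obtain ⟨hadm₁, hadm₂, hadm₃⟩ := hadm
  have hθ_pos : 0 < θ₁ := by
    rw [hθ₁, Real.arccos_pos, div_lt_one (by positivity)]
    nlinarith [mul_pos (sub_pos.2 hadm₁) (sub_pos.2 hadm₂)]
  have hθ_lt : θ₁ < Real.pi := by
    refine hθ₁ ▸ (Real.arccos_le_pi _).lt_of_ne fun h => ?_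
    rw [Real.arccos_eq_pi, div_le_iff₀ (by positivity)] at h
    nlinarith [mul_pos (sub_pos.2 hadm₃) (show 0 < l₁₂ + l₁₃ + l₂₃ by linarith)]
  refine ⟨hd, hd', ?_⟩
  rw [hh₁₂₃, hh₁₃₂]
  exact arctan_add_arctan_eq_angle hd hd' hθ_pos hθ_lt
end

section
/- Fix r₁, r₂ > 0 and weights I₁, I₂, I₃ > 1, and suppose (r₁, r₂, r̂₃) and (r₁, r₂, r̄₃) are generalized inversive distance circle packings (non-strict triangle inequalities hold) with r̂₃ < r̄₃. Then the extended angle function r₃ ↦ θ_{12,3}(r₁, r₂, r₃) is strictly increasing on the closed interval [r̂₃, r̄₃]. -/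
/-- Admissibility of the triple `p`. -/
def admissibleP (I₁ I₂ I₃ : ℝ) (p : ℝ × ℝ × ℝ) : Prop :=
  l12 I₃ p < l13 I₂ p + l23 I₁ p ∧
  l13 I₂ p < l12 I₃ p + l23 I₁ p ∧
  l23 I₁ p < l12 I₃ p + l13 I₂ p

/-- The non-strict triangle inequalities (generalized packing) for the triple `p`. -/
def generalizedP (I₁ I₂ I₃ : ℝ) (p : ℝ × ℝ × ℝ) : Prop :=
  l12 I₃ p ≤ l13 I₂ p + l23 I₁ p ∧
  l13 I₂ p ≤ l12 I₃ p + l23 I₁ p ∧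
  l23 I₁ p ≤ l12 I₃ p + l13 I₂ p

/-- `d₁₂ = (r₁² + r₁r₂I₃)/l₁₂`. -/
noncomputable def d12 (I₃ : ℝ) (p : ℝ × ℝ × ℝ) : ℝ :=
  (p.1 ^ 2 + p.1 * p.2.1 * I₃) / l12 I₃ p

theorem add_lt_lenr {I a b : ℝ} (hI : 1 < I) (ha : 0 < a) (hb : 0 < b) :
    a + b < lenr I a b := by
  refine Real.lt_sqrt_of_sq_lt ?_
  nlinarith [mul_pos ha hb, mul_pos (mul_pos ha hb) (sub_pos.2 hI)]

/-- The square of the signed area `A`, as a polynomial in the radii and the weights. -/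
def areaSq (I₁ I₂ I₃ a b t : ℝ) : ℝ :=
  b ^ 2 * t ^ 2 * (1 - I₁ ^ 2) + a ^ 2 * t ^ 2 * (1 - I₂ ^ 2) + a ^ 2 * b ^ 2 * (1 - I₃ ^ 2) +
    2 * a * b * t ^ 2 * (I₃ + I₁ * I₂) + 2 * a * b ^ 2 * t * (I₂ + I₁ * I₃) +
    2 * a ^ 2 * b * t * (I₁ + I₂ * I₃)

/-- The function `r₁ r₂ h₃`, in terms of the radii. -/
noncomputable def height (I₁ I₂ I₃ a b t : ℝ) : ℝ :=
  b * (I₂ + I₁ * I₃) + a * (I₁ + I₂ * I₃) - a * b * (I₃ ^ 2 - 1) / t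

/-- The square of the value of `height` at which the triangle degenerates. -/
def heightBound (I₁ I₂ I₃ a b : ℝ) : ℝ :=
  (I₁ ^ 2 + I₂ ^ 2 + I₃ ^ 2 - 1 + 2 * I₁ * I₂ * I₃) * (a ^ 2 + b ^ 2 + 2 * a * b * I₃)

theorem heightBound_pos {I₁ I₂ I₃ a b : ℝ} (hI₁ : 1 < I₁) (hI₂ : 1 < I₂) (hI₃ : 1 < I₃)
    (ha : 0 < a) (hb : 0 < b) : 0 < heightBound I₁ I₂ I₃ a b := by
  have : 0 < I₁ ^ 2 - 1 := by nlinarith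
  have : 0 < I₁ ^ 2 + I₂ ^ 2 + I₃ ^ 2 - 1 + 2 * I₁ * I₂ * I₃ := by
    have : 0 < I₂ ^ 2 + I₃ ^ 2 + 2 * I₁ * I₂ * I₃ := by positivity
    linarith
  unfold heightBound
  positivity

theorem height_lt_height {I₁ I₂ I₃ a b s t : ℝ} (hI₃ : 1 < I₃) (ha : 0 < a) (hb : 0 < b)
    (hs : 0 < s) (hst : s < t) : height I₁ I₂ I₃ a b s < height I₁ I₂ I₃ a b t := by
  have : 0 < I₃ ^ 2 - 1 := by nlinarith
  unfold height
  gcongr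

theorem areaSq_eq_height {I₁ I₂ I₃ a b t : ℝ} (ht : 0 < t) :
    (I₃ ^ 2 - 1) * areaSq I₁ I₂ I₃ a b t =
      t ^ 2 * (heightBound I₁ I₂ I₃ a b - height I₁ I₂ I₃ a b t ^ 2) := by
  unfold areaSq height heightBound
  field_simp
  ring

theorem heron_s10 {I₁ I₂ I₃ a b t : ℝ} (hI₁ : 1 < I₁) (hI₂ : 1 < I₂) (hI₃ : 1 < I₃)
    (ha : 0 < a) (hb : 0 < b) (ht : 0 < t) :
    (lenr I₃ a b + lenr I₂ a t + lenr I₁ b t) * ((lenr I₂ a t + lenr I₁ b t - lenr I₃ a b) *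
      (lenr I₃ a b + lenr I₁ b t - lenr I₂ a t) * (lenr I₃ a b + lenr I₂ a t - lenr I₁ b t)) =
      4 * areaSq I₁ I₂ I₃ a b t := by
  have h3 := lenr_sq hI₃ ha hb
  have h2 := lenr_sq hI₂ ha ht
  have h1 := lenr_sq hI₁ hb ht
  generalize lenr I₃ a b = L at *
  generalize lenr I₂ a t = p at *
  generalize lenr I₁ b t = q at *
  have e : (L + p + q) * ((p + q - L) * (L + q - p) * (L + p - q)) =
      4 * L ^ 2 * p ^ 2 - (L ^ 2 + p ^ 2 - q ^ 2) ^ 2 := by ring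
  rw [e, h1, h2, h3, areaSq]
  ring

theorem areaSq_nonneg_of_generalizedP {I₁ I₂ I₃ a b t : ℝ} (hI₁ : 1 < I₁) (hI₂ : 1 < I₂)
    (hI₃ : 1 < I₃) (ha : 0 < a) (hb : 0 < b) (ht : 0 < t)
    (h : generalizedP I₁ I₂ I₃ (a, b, t)) : 0 ≤ areaSq I₁ I₂ I₃ a b t := by
  have hh := heron_s10 hI₁ hI₂ hI₃ ha hb ht
  have := lenr_pos hI₃ ha hb
  have := lenr_pos hI₂ ha ht
  have := lenr_pos hI₁ hb ht
  obtain ⟨h1, h2, h3⟩ := h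
  simp only [l12, l13, l23] at h1 h2 h3
  rw [← sub_nonneg] at h1 h2 h3
  have : 0 ≤ 4 * areaSq I₁ I₂ I₃ a b t := hh ▸ by positivity
  linarith

theorem admissibleP_of_areaSq_pos {I₁ I₂ I₃ a b t : ℝ} (hI₁ : 1 < I₁) (hI₂ : 1 < I₂)
    (hI₃ : 1 < I₃) (ha : 0 < a) (hb : 0 < b) (ht : 0 < t)
    (h : 0 < areaSq I₁ I₂ I₃ a b t) : admissibleP I₁ I₂ I₃ (a, b, t) := by
  have hh := heron_s10 hI₁ hI₂ hI₃ ha hb ht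
  have hL := lenr_pos hI₃ ha hb
  have hp := lenr_pos hI₂ ha ht
  have hq := lenr_pos hI₁ hb ht
  simp only [admissibleP, l12, l13, l23]
  generalize lenr I₃ a b = L at *
  generalize lenr I₂ a t = p at *
  generalize lenr I₁ b t = q at *
  have hpos : 0 < (p + q - L) * (L + q - p) * (L + p - q) :=
    pos_of_mul_pos_right (by linarith) (by positivity : 0 ≤ L + p + q)
  refine ⟨?_, ?_, ?_⟩ <;> by_contra! hc
  · have : 0 < (L + q - p) * (L + p - q) := mul_pos (by linarith) (by linarith)
    nlinarith
  · have : 0 < (p + q - L) * (L + p - q) := mul_pos (by linarith) (by linarith)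
    nlinarith
  · have : 0 < (p + q - L) * (L + q - p) := mul_pos (by linarith) (by linarith)
    nlinarith

theorem flat_of_areaSq_eq_zero {I₁ I₂ I₃ a b t : ℝ} (hI₁ : 1 < I₁) (hI₂ : 1 < I₂)
    (hI₃ : 1 < I₃) (ha : 0 < a) (hb : 0 < b) (ht : 0 < t)
    (h : areaSq I₁ I₂ I₃ a b t = 0) :
    lenr I₃ a b = lenr I₂ a t + lenr I₁ b t ∨ lenr I₁ b t = lenr I₃ a b + lenr I₂ a t ∨
      lenr I₂ a t = lenr I₃ a b + lenr I₁ b t := by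
  have hh := heron_s10 hI₁ hI₂ hI₃ ha hb ht
  have hL := lenr_pos hI₃ ha hb
  have hp := lenr_pos hI₂ ha ht
  have hq := lenr_pos hI₁ hb ht
  rw [h, mul_zero, mul_eq_zero, mul_eq_zero, mul_eq_zero] at hh
  rcases hh with h | (h | h) | h
  · linarith
  · exact Or.inl (by linarith)
  · exact Or.inr (Or.inr (by linarith))
  · exact Or.inr (Or.inl (by linarith))

theorem height_eq_lenr {I₁ I₂ I₃ a b t : ℝ} (hI₁ : 1 < I₁) (hI₂ : 1 < I₂)
    (hI₃ : 1 < I₃) (ha : 0 < a) (hb : 0 < b) (ht : 0 < t) :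
    2 * (a * b * t) * height I₁ I₂ I₃ a b t =
      lenr I₁ b t ^ 2 * (a * b * I₃ + a ^ 2) + lenr I₂ a t ^ 2 * (a * b * I₃ + b ^ 2) -
        lenr I₃ a b ^ 2 * (t ^ 2 + a * b * I₃) := by
  rw [lenr_sq hI₃ ha hb, lenr_sq hI₂ ha ht, lenr_sq hI₁ hb ht, height]
  field_simp
  ring

/-- The height is negative when the third vertex is flat. -/
theorem height_neg_of_flat {I₁ I₂ I₃ a b t : ℝ} (hI₁ : 1 < I₁) (hI₂ : 1 < I₂)
    (hI₃ : 1 < I₃) (ha : 0 < a) (hb : 0 < b) (ht : 0 < t)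
    (h : lenr I₃ a b = lenr I₂ a t + lenr I₁ b t) : height I₁ I₂ I₃ a b t < 0 := by
  have hh := height_eq_lenr hI₁ hI₂ hI₃ ha hb ht
  have hL := lenr_pos hI₃ ha hb
  have hp := add_lt_lenr hI₂ ha ht
  have hq := add_lt_lenr hI₁ hb ht
  have h3 := lenr_sq hI₃ ha hb
  generalize height I₁ I₂ I₃ a b t = y at *
  generalize lenr I₃ a b = L at *
  generalize lenr I₂ a t = p at *
  generalize lenr I₁ b t = q at *
  obtain ⟨c, hc⟩ : ∃ c, c = a * b * I₃ := ⟨_, rfl⟩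
  have h3' : L ^ 2 = a ^ 2 + b ^ 2 + 2 * c := by rw [h3, hc]; ring
  rw [← hc] at hh
  have hab : 0 < a * b := mul_pos ha hb
  have hcab : a * b < c := by rw [hc]; nlinarith
  have hc0 : 0 < c := hab.trans hcab
  have hLa : L * a < c + a ^ 2 :=
    lt_of_pow_lt_pow_left₀ 2 (by positivity) (by rw [mul_pow, h3']; nlinarith)
  have hLb : L * b < c + b ^ 2 :=
    lt_of_pow_lt_pow_left₀ 2 (by positivity) (by rw [mul_pow, h3']; nlinarith)
  have hq' : q = L - p := by linarith
  have key : 2 * (a * b * t) * y = L * (L * p ^ 2 - 2 * p * (c + a ^ 2) + L * (a ^ 2 - t ^ 2)) := by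
    rw [hh, hq']
    linear_combination (-(p ^ 2)) * h3'
  have quad : L * p ^ 2 - 2 * p * (c + a ^ 2) + L * (a ^ 2 - t ^ 2) < 0 := by
    have hα : 0 < p - a - t := by linarith
    have hβ : 0 < q - b - t := by linarith
    have hw : 0 < p - a - t + (q - b - t) := by linarith
    refine neg_of_mul_neg_left (b := p - a - t + (q - b - t)) ?_ hw.le
    have e : (L * p ^ 2 - 2 * p * (c + a ^ 2) + L * (a ^ 2 - t ^ 2)) *
          (p - a - t + (q - b - t)) =
        -(2 * (q - b - t) * (a + t) * (c + a ^ 2 - L * a) +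
          2 * (p - a - t) * (b + t) * (c + b ^ 2 - L * b) +
          L * (p - a - t) * (q - b - t) * (p - a - t + (q - b - t))) := by
      have hc' : c = (L ^ 2 - a ^ 2 - b ^ 2) / 2 := by linarith
      rw [hc', hq']
      ring
    rw [e, neg_lt_zero]
    have := sub_pos.2 hLa
    have := sub_pos.2 hLb
    positivity
  have : 2 * (a * b * t) * y < 0 := key ▸ mul_neg_of_pos_of_neg hL quad
  exact neg_of_mul_neg_right this (by positivity)

/-- The height is positive when the first or the second vertex is flat. -/
theorem height_pos_of_flat {I₁ I₂ I₃ a b t : ℝ} (hI₁ : 1 < I₁) (hI₂ : 1 < I₂)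
    (hI₃ : 1 < I₃) (ha : 0 < a) (hb : 0 < b) (ht : 0 < t)
    (h : lenr I₁ b t = lenr I₃ a b + lenr I₂ a t ∨
      lenr I₂ a t = lenr I₃ a b + lenr I₁ b t) : 0 < height I₁ I₂ I₃ a b t := by
  have hh := height_eq_lenr hI₁ hI₂ hI₃ ha hb ht
  have hL := lenr_pos hI₃ ha hb
  have hp := add_lt_lenr hI₂ ha ht
  have hq := add_lt_lenr hI₁ hb ht
  have h3 := lenr_sq hI₃ ha hb
  generalize height I₁ I₂ I₃ a b t = y at *
  generalize lenr I₃ a b = L at *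
  generalize lenr I₂ a t = p at *
  generalize lenr I₁ b t = q at *
  have hp0 : 0 < p := by linarith
  have hq0 : 0 < q := by linarith
  have hpt : 0 < p ^ 2 - t ^ 2 := by nlinarith
  have hqt : 0 < q ^ 2 - t ^ 2 := by nlinarith
  have : 0 < 2 * (a * b * t) * y := by
    rcases h with h | h
    · have e : 2 * (a * b * t) * y =
          L ^ 2 * (a ^ 2 + (p ^ 2 - t ^ 2)) + 2 * L * p * (a * b * I₃ + a ^ 2) := by
        rw [hh, h]
        linear_combination (-(p ^ 2)) * h3
      rw [e]
      positivity
    · have e : 2 * (a * b * t) * y =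
          L ^ 2 * (b ^ 2 + (q ^ 2 - t ^ 2)) + 2 * L * q * (a * b * I₃ + b ^ 2) := by
        rw [hh, h]
        linear_combination (-(q ^ 2)) * h3
      rw [e]
      positivity
  exact pos_of_mul_pos_right this (by positivity)

theorem areaA_eq_sqrt {I₁ I₂ I₃ a b t : ℝ} (hI₁ : 1 < I₁) (hI₂ : 1 < I₂)
    (hI₃ : 1 < I₃) (ha : 0 < a) (hb : 0 < b) (ht : 0 < t) :
    areaA I₁ I₂ I₃ (a, b, t) = √(areaSq I₁ I₂ I₃ a b t) := by
  have hh := heron_s10 hI₁ hI₂ hI₃ ha hb ht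
  have hL := lenr_pos hI₃ ha hb
  have hp := lenr_pos hI₂ ha ht
  simp only [areaA, theta1', l12, l13, l23, Real.sin_arccos]
  generalize lenr I₃ a b = L at *
  generalize lenr I₂ a t = p at *
  generalize lenr I₁ b t = q at *
  rw [← Real.sqrt_sq (mul_pos hL hp).le, ← Real.sqrt_mul (sq_nonneg _)]
  congr 1
  field_simp
  linear_combination hh

theorem H123_div_d12 {I₁ I₂ I₃ a b t : ℝ} (hI₁ : 1 < I₁) (hI₂ : 1 < I₂)
    (hI₃ : 1 < I₃) (ha : 0 < a) (hb : 0 < b) (ht : 0 < t) (hA : 0 < areaSq I₁ I₂ I₃ a b t) :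
    H123 I₁ I₂ I₃ (a, b, t) / d12 I₃ (a, b, t) =
      b * √(I₃ ^ 2 - 1) / (a + b * I₃) *
        (height I₁ I₂ I₃ a b t / √(heightBound I₁ I₂ I₃ a b - height I₁ I₂ I₃ a b t ^ 2)) := by
  have hM : 0 < I₃ ^ 2 - 1 := by nlinarith
  have hs : √(I₃ ^ 2 - 1) * √(areaSq I₁ I₂ I₃ a b t) =
      t * √(heightBound I₁ I₂ I₃ a b - height I₁ I₂ I₃ a b t ^ 2) := by
    rw [← Real.sqrt_mul hM.le, areaSq_eq_height ht, Real.sqrt_mul (sq_nonneg t),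
      Real.sqrt_sq ht.le]
  have hA' := Real.sqrt_pos.2 hA
  have hM' := Real.sqrt_pos.2 hM
  have hd : 0 < √(heightBound I₁ I₂ I₃ a b - height I₁ I₂ I₃ a b t ^ 2) :=
    pos_of_mul_pos_right (hs ▸ mul_pos hM' hA') ht.le
  have hL := lenr_pos hI₃ ha hb
  have hnum : hfun3 I₁ I₂ I₃ (a, b, t) * (a * b) = height I₁ I₂ I₃ a b t := by
    simp only [hfun3, height]
    field_simp
    ring
  simp only [H123, d12, l12, areaA_eq_sqrt hI₁ hI₂ hI₃ ha hb ht]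
  rw [← hnum] at hs hd ⊢
  generalize √(areaSq I₁ I₂ I₃ a b t) = A at *
  generalize √(I₃ ^ 2 - 1) = m at *
  generalize √(heightBound I₁ I₂ I₃ a b - _) = e at *
  generalize hfun3 I₁ I₂ I₃ (a, b, t) = h at *
  have : 0 < a + b * I₃ := by positivity
  field_simp
  linear_combination (-h) * hs

theorem div_sqrt_sub_sq_lt {K x y : ℝ} (hx : x ^ 2 < K) (hy : y ^ 2 < K) (hxy : x < y) :
    x / √(K - x ^ 2) < y / √(K - y ^ 2) := by
  have hp := Real.sqrt_pos.2 (sub_pos.2 hx)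
  have hq := Real.sqrt_pos.2 (sub_pos.2 hy)
  have hp2 := Real.sq_sqrt (sub_pos.2 hx).le
  have hq2 := Real.sq_sqrt (sub_pos.2 hy).le
  generalize √(K - x ^ 2) = p at *
  generalize √(K - y ^ 2) = q at *
  rw [div_lt_div_iff₀ hp hq, ← sub_pos]
  have e : (y * p - x * q) * (p + q) = (y - x) * (K + x * y + p * q) := by
    linear_combination y * hp2 - x * hq2
  have hpos : 0 < (y - x) * (K + x * y + p * q) :=
    mul_pos (sub_pos.2 hxy) (by nlinarith [sq_nonneg (x + y), mul_pos hp hq])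
  exact pos_of_mul_pos_left (e ▸ hpos) (by positivity)

/-- Lemma 2.13: with `r₁, r₂` fixed, if `(r₁, r₂, r̂₃)` and `(r₁, r₂, r̄₃)` are
generalized inversive distance circle packings with `r̂₃ < r̄₃`, then the
extended signed angle `θ₁₂,₃` (equal to `arctan(h₁₂,₃/d₁₂)` on admissible
triples, `−π/2` when `v₃` is the flat vertex and `π/2` when `v₁` or `v₂` is the
flat vertex) is strictly increasing in `r₃ ∈ [r̂₃, r̄₃]`. -/
theorem stmt_10 (I₁ I₂ I₃ r₁ r₂ rhat rbar : ℝ) (Θ : ℝ → ℝ)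
    (hI₁ : 1 < I₁) (hI₂ : 1 < I₂) (hI₃ : 1 < I₃)
    (hr₁ : 0 < r₁) (hr₂ : 0 < r₂) (hrhat : 0 < rhat) (hlt : rhat < rbar)
    (hgenhat : generalizedP I₁ I₂ I₃ (r₁, r₂, rhat))
    (hgenbar : generalizedP I₁ I₂ I₃ (r₁, r₂, rbar))
    (hΘadm : ∀ t ∈ Set.Icc rhat rbar, admissibleP I₁ I₂ I₃ (r₁, r₂, t) →
      Θ t = Real.arctan (H123 I₁ I₂ I₃ (r₁, r₂, t) / d12 I₃ (r₁, r₂, t)))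
    (hΘflat₃ : ∀ t ∈ Set.Icc rhat rbar,
      l12 I₃ (r₁, r₂, t) = l13 I₂ (r₁, r₂, t) + l23 I₁ (r₁, r₂, t) →
      Θ t = -(Real.pi / 2))
    (hΘflat₁₂ : ∀ t ∈ Set.Icc rhat rbar,
      (l23 I₁ (r₁, r₂, t) = l12 I₃ (r₁, r₂, t) + l13 I₂ (r₁, r₂, t) ∨
       l13 I₂ (r₁, r₂, t) = l12 I₃ (r₁, r₂, t) + l23 I₁ (r₁, r₂, t)) →
      Θ t = Real.pi / 2) :
    StrictMonoOn Θ (Set.Icc rhat rbar) := by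
  have hb := heightBound_pos hI₁ hI₂ hI₃ hr₁ hr₂
  have hM : 0 < I₃ ^ 2 - 1 := by nlinarith
  have hmono : ∀ {s t}, rhat ≤ s → s < t →
      height I₁ I₂ I₃ r₁ r₂ s < height I₁ I₂ I₃ r₁ r₂ t := fun hs hst =>
    height_lt_height hI₃ hr₁ hr₂ (hrhat.trans_le hs) hst
  have hend : ∀ {t}, 0 < t → generalizedP I₁ I₂ I₃ (r₁, r₂, t) →
      height I₁ I₂ I₃ r₁ r₂ t ^ 2 ≤ heightBound I₁ I₂ I₃ r₁ r₂ := fun ht h => by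
    have h1 := mul_nonneg hM.le (areaSq_nonneg_of_generalizedP hI₁ hI₂ hI₃ hr₁ hr₂ ht h)
    rw [areaSq_eq_height ht] at h1
    exact sub_nonneg.1 (nonneg_of_mul_nonneg_right h1 (by positivity))
  have hle : ∀ t ∈ Set.Icc rhat rbar,
      height I₁ I₂ I₃ r₁ r₂ t ^ 2 ≤ heightBound I₁ I₂ I₃ r₁ r₂ := by
    rintro t ⟨h1, h2⟩
    rcases h1.eq_or_lt with rfl | h1
    · exact hend hrhat hgenhat
    rcases h2.eq_or_lt with rfl | h2
    · exact hend (hrhat.trans hlt) hgenbar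
    have hlo := abs_le.1 (Real.abs_le_sqrt (hend hrhat hgenhat))
    have hhi := abs_le.1 (Real.abs_le_sqrt (hend (hrhat.trans hlt) hgenbar))
    have := hmono le_rfl h1
    have := hmono h1.le h2
    exact Real.sq_le hb.le |>.2 ⟨by linarith, by linarith⟩
  have hadm : ∀ t ∈ Set.Icc rhat rbar,
      height I₁ I₂ I₃ r₁ r₂ t ^ 2 < heightBound I₁ I₂ I₃ r₁ r₂ →
      Θ t = Real.arctan (r₂ * √(I₃ ^ 2 - 1) / (r₁ + r₂ * I₃) *
        (height I₁ I₂ I₃ r₁ r₂ t /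
          √(heightBound I₁ I₂ I₃ r₁ r₂ - height I₁ I₂ I₃ r₁ r₂ t ^ 2))) := by
    intro t ht h
    have ht0 : 0 < t := hrhat.trans_le ht.1
    have hA : 0 < areaSq I₁ I₂ I₃ r₁ r₂ t := by
      refine pos_of_mul_pos_right ?_ hM.le
      rw [areaSq_eq_height ht0]
      exact mul_pos (by positivity) (sub_pos.2 h)
    rw [hΘadm t ht (admissibleP_of_areaSq_pos hI₁ hI₂ hI₃ hr₁ hr₂ ht0 hA),
      H123_div_d12 hI₁ hI₂ hI₃ hr₁ hr₂ ht0 hA]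
  have hflat : ∀ t ∈ Set.Icc rhat rbar,
      height I₁ I₂ I₃ r₁ r₂ t ^ 2 = heightBound I₁ I₂ I₃ r₁ r₂ →
      (height I₁ I₂ I₃ r₁ r₂ t < 0 ∧ Θ t = -(Real.pi / 2)) ∨
        (0 < height I₁ I₂ I₃ r₁ r₂ t ∧ Θ t = Real.pi / 2) := by
    intro t ht h
    have ht0 : 0 < t := hrhat.trans_le ht.1
    have hA : areaSq I₁ I₂ I₃ r₁ r₂ t = 0 := by
      have h1 := areaSq_eq_height (I₁ := I₁) (I₂ := I₂) (I₃ := I₃) (a := r₁) (b := r₂) ht0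
      rw [h, sub_self, mul_zero] at h1
      exact (mul_eq_zero.1 h1).resolve_left hM.ne'
    rcases flat_of_areaSq_eq_zero hI₁ hI₂ hI₃ hr₁ hr₂ ht0 hA with h3 | h12
    · exact Or.inl ⟨height_neg_of_flat hI₁ hI₂ hI₃ hr₁ hr₂ ht0 h3, hΘflat₃ t ht h3⟩
    · exact Or.inr ⟨height_pos_of_flat hI₁ hI₂ hI₃ hr₁ hr₂ ht0 h12, hΘflat₁₂ t ht h12⟩
  intro s hs t ht hst
  have hy := hmono hs.1 hst
  have hsle := hle s hs
  have htle := hle t ht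
  rcases hsle.eq_or_lt with hs' | hs'
  · rcases hflat s hs hs' with ⟨hneg, hΘs⟩ | ⟨hpos, -⟩
    · rw [hΘs]
      rcases htle.eq_or_lt with ht' | ht'
      · rcases hflat t ht ht' with ⟨hneg', -⟩ | ⟨-, hΘt⟩
        · nlinarith
        · rw [hΘt]
          linarith [Real.pi_pos]
      · rw [hadm t ht ht']
        exact Real.neg_pi_div_two_lt_arctan _
    · nlinarith
  · rw [hadm s hs hs']
    rcases htle.eq_or_lt with ht' | ht'
    · rcases hflat t ht ht' with ⟨hneg', -⟩ | ⟨-, hΘt⟩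
      · nlinarith
      · rw [hΘt]
        exact Real.arctan_lt_pi_div_two _
    · rw [hadm t ht ht']
      have hM' := Real.sqrt_pos.2 hM
      refine Real.arctan_strictMono (mul_lt_mul_of_pos_left (div_sqrt_sub_sq_lt hs' ht' hy) ?_)
      positivity
end

section
/- For every admissible triple (r₁, r₂, r₃), viewing h_{12,3} as a function of κ₃ = 1/r₃ with r₁, r₂ fixed, one has ∂h_{12,3}/∂κ₃ = (r₁⁴ r₂⁴ r₃³/(A³ l₁₂)) · (1 − I₁² − I₂² − I₃² − 2I₁I₂I₃) · (κ₁² + κ₂² + 2κ₁κ₂ I₃), and in particular ∂h_{12,3}/∂κ₃ < 0. -/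
/-- The quadratic form `∑ κᵢ²(1 − Iᵢ²) + 2 ∑ κᵢκⱼγₖ` in the curvatures, which is
`A² / (r₁r₂r₃)²`. -/
def curvatureForm (I₁ I₂ I₃ x y z : ℝ) : ℝ :=
  x ^ 2 * (1 - I₁ ^ 2) + y ^ 2 * (1 - I₂ ^ 2) + z ^ 2 * (1 - I₃ ^ 2) +
    2 * x * y * (I₃ + I₁ * I₂) + 2 * x * z * (I₂ + I₁ * I₃) + 2 * y * z * (I₁ + I₂ * I₃)

theorem lenr_radicand_pos {I a b : ℝ} (hI : 1 < I) (ha : 0 < a) (hb : 0 < b) :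
    0 < a ^ 2 + b ^ 2 + 2 * a * b * I := by
  have : 0 < I := by linarith
  positivity

/-- Heron's formula in terms of the curvature form. -/
theorem heron_lenr {I₁ I₂ I₃ a b c : ℝ} (hI₁ : 1 < I₁) (hI₂ : 1 < I₂) (hI₃ : 1 < I₃)
    (ha : 0 < a) (hb : 0 < b) (hc : 0 < c) :
    4 * lenr I₃ a b ^ 2 * lenr I₂ a c ^ 2
        - (lenr I₃ a b ^ 2 + lenr I₂ a c ^ 2 - lenr I₁ b c ^ 2) ^ 2 =
      4 * (a * b * c) ^ 2 * curvatureForm I₁ I₂ I₃ (1 / a) (1 / b) (1 / c) := by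
  rw [lenr_sq hI₃ ha hb, lenr_sq hI₂ ha hc, lenr_sq hI₁ hb hc, curvatureForm]
  field_simp
  ring

theorem areaA_eq {I₁ I₂ I₃ a b c : ℝ} (hI₁ : 1 < I₁) (hI₂ : 1 < I₂) (hI₃ : 1 < I₃)
    (ha : 0 < a) (hb : 0 < b) (hc : 0 < c) :
    areaA I₁ I₂ I₃ (a, b, c) =
      a * b * c * Real.sqrt (curvatureForm I₁ I₂ I₃ (1 / a) (1 / b) (1 / c)) := by
  have heron := heron_lenr hI₁ hI₂ hI₃ ha hb hc
  have hx := lenr_pos hI₃ ha hb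
  have hy := lenr_pos hI₂ ha hc
  simp only [areaA, theta1', l12, l13, l23, Real.sin_arccos]
  generalize lenr I₃ a b = x at *
  generalize lenr I₂ a c = y at *
  generalize lenr I₁ b c = w at *
  rw [← Real.sqrt_sq (by positivity : 0 ≤ x * y), ← Real.sqrt_mul (by positivity),
    ← Real.sqrt_sq (by positivity : 0 ≤ a * b * c), ← Real.sqrt_mul (by positivity)]
  congr 1
  field_simp
  linarith

theorem curvatureForm_pos {I₁ I₂ I₃ a b c : ℝ} (hI₁ : 1 < I₁) (hI₂ : 1 < I₂) (hI₃ : 1 < I₃)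
    (ha : 0 < a) (hb : 0 < b) (hc : 0 < c)
    (h₃ : lenr I₃ a b < lenr I₂ a c + lenr I₁ b c)
    (h₂ : lenr I₂ a c < lenr I₃ a b + lenr I₁ b c)
    (h₁ : lenr I₁ b c < lenr I₃ a b + lenr I₂ a c) :
    0 < curvatureForm I₁ I₂ I₃ (1 / a) (1 / b) (1 / c) := by
  have heron := heron_lenr hI₁ hI₂ hI₃ ha hb hc
  have hx := lenr_pos hI₃ ha hb
  have hy := lenr_pos hI₂ ha hc
  have hw := lenr_pos hI₁ hb hc
  generalize lenr I₃ a b = x at *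
  generalize lenr I₂ a c = y at *
  generalize lenr I₁ b c = w at *
  have hprod : 0 < (x + y + w) * (x + y - w) * ((x + w - y) * (y + w - x)) :=
    mul_pos (mul_pos (by linarith) (by linarith)) (mul_pos (by linarith) (by linarith))
  have hpos : 0 < 4 * (a * b * c) ^ 2 * curvatureForm I₁ I₂ I₃ (1 / a) (1 / b) (1 / c) := by
    rw [← heron]
    linarith
  exact (mul_pos_iff_of_pos_left (by positivity)).1 hpos

theorem H123_eq {I₁ I₂ I₃ a b κ : ℝ} (hI₁ : 1 < I₁) (hI₂ : 1 < I₂) (hI₃ : 1 < I₃)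
    (ha : 0 < a) (hb : 0 < b) (hκ : 0 < κ) :
    H123 I₁ I₂ I₃ (a, b, 1 / κ) =
      a * b / lenr I₃ a b *
        ((κ * (1 - I₃ ^ 2) + (1 / a) * (I₂ + I₁ * I₃) + (1 / b) * (I₁ + I₂ * I₃)) /
          Real.sqrt (curvatureForm I₁ I₂ I₃ (1 / a) (1 / b) κ)) := by
  have hL := lenr_pos hI₃ ha hb
  simp only [H123, hfun3, l12, areaA_eq hI₁ hI₂ hI₃ ha hb (one_div_pos.2 hκ), one_div_one_div]
  generalize κ * (1 - I₃ ^ 2) + (1 / a) * (I₂ + I₁ * I₃) + (1 / b) * (I₁ + I₂ * I₃) = h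
  generalize Real.sqrt (curvatureForm I₁ I₂ I₃ (1 / a) (1 / b) κ) = s
  rcases eq_or_ne s 0 with rfl | hs
  · simp
  · field_simp

/-- With `h = ½ ∂S/∂z` for the curvature form `S`, the quotient `h / √S` has derivative
`((1 − I₃²) S − h²) / S^(3/2)`, and the numerator factors. -/
theorem hasDerivAt_div_sqrt_curvatureForm {I₁ I₂ I₃ x y z : ℝ}
    (hS : 0 < curvatureForm I₁ I₂ I₃ x y z) :
    HasDerivAt (fun z => (z * (1 - I₃ ^ 2) + x * (I₂ + I₁ * I₃) + y * (I₁ + I₂ * I₃)) /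
        Real.sqrt (curvatureForm I₁ I₂ I₃ x y z))
      ((1 - I₁ ^ 2 - I₂ ^ 2 - I₃ ^ 2 - 2 * I₁ * I₂ * I₃) * (x ^ 2 + y ^ 2 + 2 * x * y * I₃) /
        Real.sqrt (curvatureForm I₁ I₂ I₃ x y z) ^ 3) z := by
  have hnum : HasDerivAt
      (fun z => z * (1 - I₃ ^ 2) + x * (I₂ + I₁ * I₃) + y * (I₁ + I₂ * I₃)) (1 - I₃ ^ 2) z := by
    simpa using (((hasDerivAt_id z).mul_const (1 - I₃ ^ 2)).add_const
      (x * (I₂ + I₁ * I₃))).add_const (y * (I₁ + I₂ * I₃))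
  have hform : HasDerivAt (fun z => curvatureForm I₁ I₂ I₃ x y z)
      (2 * (z * (1 - I₃ ^ 2) + x * (I₂ + I₁ * I₃) + y * (I₁ + I₂ * I₃))) z := by
    have hsq := ((hasDerivAt_id z).pow 2).mul_const (1 - I₃ ^ 2)
    have hlin := (hasDerivAt_id z).mul_const (2 * x * (I₂ + I₁ * I₃) + 2 * y * (I₁ + I₂ * I₃))
    have h := (hsq.add hlin).add_const
      (x ^ 2 * (1 - I₁ ^ 2) + y ^ 2 * (1 - I₂ ^ 2) + 2 * x * y * (I₃ + I₁ * I₂))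
    refine (h.congr_of_eventuallyEq (.of_forall fun t => ?_)).congr_deriv ?_
    · simp [curvatureForm]
      ring
    · simp
      ring
  have hs := Real.sqrt_pos.2 hS
  refine (hnum.div (hform.sqrt hS.ne') hs.ne').congr_deriv ?_
  have hs2 := Real.sq_sqrt hS.le
  generalize Real.sqrt (curvatureForm I₁ I₂ I₃ x y z) = s at *
  field_simp
  rw [hs2, curvatureForm]
  ring

/-- Equation (2.13): for an admissible triple, viewing `h₁₂,₃` as a function of
`κ₃ = 1/r₃` with `r₁, r₂` fixed,
`∂h₁₂,₃/∂κ₃ = (r₁⁴r₂⁴r₃³/(A³l₁₂))·(1 − I₁² − I₂² − I₃² − 2I₁I₂I₃)·(κ₁² + κ₂² + 2κ₁κ₂I₃) < 0`. -/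
theorem stmt_11 (I₁ I₂ I₃ r₁ r₂ r₃ κ₁ κ₂ κ₃ A L₁₂ D : ℝ)
    (hI₁ : 1 < I₁) (hI₂ : 1 < I₂) (hI₃ : 1 < I₃)
    (hr₁ : 0 < r₁) (hr₂ : 0 < r₂) (hr₃ : 0 < r₃)
    (hadm : l12 I₃ (r₁, r₂, r₃) < l13 I₂ (r₁, r₂, r₃) + l23 I₁ (r₁, r₂, r₃) ∧
      l13 I₂ (r₁, r₂, r₃) < l12 I₃ (r₁, r₂, r₃) + l23 I₁ (r₁, r₂, r₃) ∧
      l23 I₁ (r₁, r₂, r₃) < l12 I₃ (r₁, r₂, r₃) + l13 I₂ (r₁, r₂, r₃))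
    (hκ₁ : κ₁ = 1 / r₁) (hκ₂ : κ₂ = 1 / r₂) (hκ₃ : κ₃ = 1 / r₃)
    (hA : A = areaA I₁ I₂ I₃ (r₁, r₂, r₃)) (hL₁₂ : L₁₂ = l12 I₃ (r₁, r₂, r₃))
    (hD : D = r₁ ^ 4 * r₂ ^ 4 * r₃ ^ 3 / (A ^ 3 * L₁₂)
        * (1 - I₁ ^ 2 - I₂ ^ 2 - I₃ ^ 2 - 2 * I₁ * I₂ * I₃)
        * (κ₁ ^ 2 + κ₂ ^ 2 + 2 * κ₁ * κ₂ * I₃)) :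
    HasDerivAt (fun κ : ℝ => H123 I₁ I₂ I₃ (r₁, r₂, 1 / κ)) D κ₃ ∧ D < 0 := by
  obtain ⟨h₃, h₂, h₁⟩ := hadm
  simp only [l12, l13, l23] at h₁ h₂ h₃
  have hS := curvatureForm_pos hI₁ hI₂ hI₃ hr₁ hr₂ hr₃ h₃ h₂ h₁
  have hs := Real.sqrt_pos.2 hS
  have hL := lenr_pos hI₃ hr₁ hr₂
  have hκ₃_pos : 0 < κ₃ := hκ₃ ▸ one_div_pos.2 hr₃
  rw [areaA_eq hI₁ hI₂ hI₃ hr₁ hr₂ hr₃] at hA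
  have hA_pos : 0 < A := by rw [hA]; positivity
  have hL_pos : 0 < L₁₂ := hL₁₂ ▸ hL
  constructor
  · rw [← hκ₁, ← hκ₂, ← hκ₃] at hS hs hA
    have hderiv := (hasDerivAt_div_sqrt_curvatureForm hS).const_mul (r₁ * r₂ / lenr I₃ r₁ r₂)
    refine (hderiv.congr_of_eventuallyEq ?_).congr_deriv ?_
    · filter_upwards [lt_mem_nhds hκ₃_pos] with κ hκ
      rw [H123_eq hI₁ hI₂ hI₃ hr₁ hr₂ hκ, hκ₁, hκ₂]
    · rw [hD, hA, hL₁₂, l12]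
      generalize Real.sqrt (curvatureForm I₁ I₂ I₃ κ₁ κ₂ κ₃) = s at *
      field_simp
  · have hκ₁_pos : 0 < κ₁ := hκ₁ ▸ one_div_pos.2 hr₁
    have hκ₂_pos : 0 < κ₂ := hκ₂ ▸ one_div_pos.2 hr₂
    have hI : 0 < I₁ * I₂ * I₃ := by positivity
    rw [hD]
    refine mul_neg_of_neg_of_pos (mul_neg_of_pos_of_neg (by positivity) ?_)
      (lenr_radicand_pos hI₃ hκ₁_pos hκ₂_pos)
    nlinarith [sq_nonneg I₂, sq_nonneg I₃]
end

section
/- For all radii r₁, r₂, r₃ > 0 and weights I₁, I₂, I₃ > 1, the following two identities hold: κ₁h₁ + κ₂h₂ + κ₃h₃ = Q, and 4 l₁₂² l₁₃² − (l₁₂² + l₁₃² − l₂₃²)² = 4 r₁² r₂² r₃² Q. In particular, for a triple satisfying the non-strict triangle inequalities, the squared triangle area quantity A² = (l₁₂ l₁₃ sin θ₁)² equals r₁² r₂² r₃² Q. -/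
/-- Law of cosines and Heron's formula combined: the angle computed by `arccos` from three
side lengths satisfying the triangle inequalities gives the expected area. -/
theorem four_mul_sq_mul_sin_arccos {a b c : ℝ} (ha : 0 < a) (hb : 0 < b)
    (hab : a ≤ b + c) (hba : b ≤ a + c) (hc : c ≤ a + b) :
    4 * (a * b * Real.sin (Real.arccos ((a ^ 2 + b ^ 2 - c ^ 2) / (2 * a * b)))) ^ 2
      = 4 * a ^ 2 * b ^ 2 - (a ^ 2 + b ^ 2 - c ^ 2) ^ 2 := by
  have key : 1 - ((a ^ 2 + b ^ 2 - c ^ 2) / (2 * a * b)) ^ 2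
      = (4 * a ^ 2 * b ^ 2 - (a ^ 2 + b ^ 2 - c ^ 2) ^ 2) / (4 * a ^ 2 * b ^ 2) := by
    field_simp
    ring
  have hnum : 0 ≤ 4 * a ^ 2 * b ^ 2 - (a ^ 2 + b ^ 2 - c ^ 2) ^ 2 := by
    have h : 0 ≤ (a + b - c) * (a + b + c) * ((b + c - a) * (a + c - b)) :=
      mul_nonneg (mul_nonneg (by linarith) (by linarith))
        (mul_nonneg (by linarith) (by linarith))
    linarith
  rw [Real.sin_arccos, mul_pow, Real.sq_sqrt (key ▸ by positivity), key]
  field_simp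


/-- The identities `κ₁h₁ + κ₂h₂ + κ₃h₃ = Q` and
`4l₁₂²l₁₃² − (l₁₂² + l₁₃² − l₂₃²)² = 4r₁²r₂²r₃²Q`; in particular, for a triple
satisfying the non-strict triangle inequalities, `A² = (l₁₂l₁₃ sin θ₁)² = r₁²r₂²r₃²Q`. -/
theorem stmt_12 (r₁ r₂ r₃ I₁ I₂ I₃ l₁₂ l₁₃ l₂₃ κ₁ κ₂ κ₃ γ₁ γ₂ γ₃ h₁ h₂ h₃ Q θ₁ : ℝ)
    (hr₁ : 0 < r₁) (hr₂ : 0 < r₂) (hr₃ : 0 < r₃)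
    (hI₁ : 1 < I₁) (hI₂ : 1 < I₂) (hI₃ : 1 < I₃)
    (hl₁₂ : l₁₂ = Real.sqrt (r₁ ^ 2 + r₂ ^ 2 + 2 * r₁ * r₂ * I₃))
    (hl₁₃ : l₁₃ = Real.sqrt (r₁ ^ 2 + r₃ ^ 2 + 2 * r₁ * r₃ * I₂))
    (hl₂₃ : l₂₃ = Real.sqrt (r₂ ^ 2 + r₃ ^ 2 + 2 * r₂ * r₃ * I₁))
    (hκ₁ : κ₁ = 1 / r₁) (hκ₂ : κ₂ = 1 / r₂) (hκ₃ : κ₃ = 1 / r₃)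
    (hγ₁ : γ₁ = I₁ + I₂ * I₃) (hγ₂ : γ₂ = I₂ + I₁ * I₃) (hγ₃ : γ₃ = I₃ + I₁ * I₂)
    (hh₁ : h₁ = κ₁ * (1 - I₁ ^ 2) + κ₂ * γ₃ + κ₃ * γ₂)
    (hh₂ : h₂ = κ₂ * (1 - I₂ ^ 2) + κ₁ * γ₃ + κ₃ * γ₁)
    (hh₃ : h₃ = κ₃ * (1 - I₃ ^ 2) + κ₁ * γ₂ + κ₂ * γ₁)
    (hQ : Q = κ₁ ^ 2 * (1 - I₁ ^ 2) + κ₂ ^ 2 * (1 - I₂ ^ 2) + κ₃ ^ 2 * (1 - I₃ ^ 2)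
        + 2 * κ₁ * κ₂ * γ₃ + 2 * κ₁ * κ₃ * γ₂ + 2 * κ₂ * κ₃ * γ₁)
    (hθ₁ : θ₁ = Real.arccos ((l₁₂ ^ 2 + l₁₃ ^ 2 - l₂₃ ^ 2) / (2 * l₁₂ * l₁₃))) :
    κ₁ * h₁ + κ₂ * h₂ + κ₃ * h₃ = Q ∧
    4 * l₁₂ ^ 2 * l₁₃ ^ 2 - (l₁₂ ^ 2 + l₁₃ ^ 2 - l₂₃ ^ 2) ^ 2
      = 4 * r₁ ^ 2 * r₂ ^ 2 * r₃ ^ 2 * Q ∧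
    ((l₁₂ ≤ l₁₃ + l₂₃ ∧ l₁₃ ≤ l₁₂ + l₂₃ ∧ l₂₃ ≤ l₁₂ + l₁₃) →
      (l₁₂ * l₁₃ * Real.sin θ₁) ^ 2 = r₁ ^ 2 * r₂ ^ 2 * r₃ ^ 2 * Q) := by
  have hl₁₂_pos : 0 < l₁₂ := by rw [hl₁₂]; positivity
  have hl₁₃_pos : 0 < l₁₃ := by rw [hl₁₃]; positivity
  have hl₁₂_sq : l₁₂ ^ 2 = r₁ ^ 2 + r₂ ^ 2 + 2 * r₁ * r₂ * I₃ := by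
    rw [hl₁₂, Real.sq_sqrt (by positivity)]
  have hl₁₃_sq : l₁₃ ^ 2 = r₁ ^ 2 + r₃ ^ 2 + 2 * r₁ * r₃ * I₂ := by
    rw [hl₁₃, Real.sq_sqrt (by positivity)]
  have hl₂₃_sq : l₂₃ ^ 2 = r₂ ^ 2 + r₃ ^ 2 + 2 * r₂ * r₃ * I₁ := by
    rw [hl₂₃, Real.sq_sqrt (by positivity)]
  have area : 4 * l₁₂ ^ 2 * l₁₃ ^ 2 - (l₁₂ ^ 2 + l₁₃ ^ 2 - l₂₃ ^ 2) ^ 2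
      = 4 * r₁ ^ 2 * r₂ ^ 2 * r₃ ^ 2 * Q := by
    rw [hl₁₂_sq, hl₁₃_sq, hl₂₃_sq, hQ, hκ₁, hκ₂, hκ₃, hγ₁, hγ₂, hγ₃]
    field_simp
    ring
  refine ⟨by rw [hh₁, hh₂, hh₃, hQ]; ring, area, fun ⟨h₁₂, h₁₃, h₂₃⟩ => ?_⟩
  have heron := four_mul_sq_mul_sin_arccos hl₁₂_pos hl₁₃_pos h₁₂ h₁₃ h₂₃
  rw [← hθ₁] at heron
  linarith
end
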